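/- Let d ∈ N and s > 1/2. Then a_n(I_d : H^{s,2}_mix(T^d) → L∞(T^d)) ≤ √(2/(2s−1)) · [ (3√2)^d/(d−1)! ]^{s} · (ln n)^{(d−1)s} / n^{s−1/2} for all n > max(27^d, e^{4(d−1)s/(2s−1)}), and a_n(I_d : H^{s,2}_mix(T^d) → L∞(T^d)) ≥ √(1/(4s−2)) · [ 5/(6·d!·(1+ln √12)^d) ]^{s} · (ln(2n))^{(d−1)s} / n^{s−1/2} for all n > (12e²)^d. -/

import Mathlib

open MeasureTheory Filter
open scoped ENNReal NNReal

noncomputable section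

/-- The index lattice `ℤ^d`. -/
abbrev ZLat (d : ℕ) := Fin d → ℤ

instance fact_two_pi_pos : Fact (0 < 2 * Real.pi) := ⟨by positivity⟩

/-- The `d`-dimensional torus `𝕋^d = [0,2π]^d` with endpoints identified. -/
abbrev Torus (d : ℕ) := Fin d → AddCircle (2 * Real.pi)

/-- The normalized Lebesgue measure `(2π)^{-d} dx` on the `d`-torus. -/
def torusMeasure (d : ℕ) : Measure (Torus d) :=
  ((ENNReal.ofReal (2 * Real.pi))⁻¹) ^ d • Measure.pi fun _ => volume

/-- The character `e^{i k·x}` on the `d`-torus. -/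
def torusChar {d : ℕ} (k : ZLat d) (x : Torus d) : ℂ :=
  ∏ j, fourier (k j) (x j)

/-- The `k`-th Fourier coefficient `f̂(k) = (2π)^{-d} ∫_{𝕋^d} f(x) e^{-i k·x} dx`. -/
def fourierCoef {d : ℕ} (f : Torus d → ℂ) (k : ZLat d) : ℂ :=
  ∫ x, (starRingEnd ℂ) (torusChar k x) * f x ∂(torusMeasure d)

/-- The `n`-th approximation number of a bounded linear operator `T`:
`a_n(T) = inf {‖T - A‖ : rank A < n}`. -/
def approxNum {X Y : Type*} [NormedAddCommGroup X] [NormedSpace ℂ X]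
    [NormedAddCommGroup Y] [NormedSpace ℂ Y] (T : X →L[ℂ] Y) (n : ℕ) : ℝ :=
  sInf {c : ℝ | ∃ A : X →L[ℂ] Y,
    Module.rank ℂ (LinearMap.range (A : X →ₗ[ℂ] Y)) < n ∧ c = ‖T - A‖}

/-- `ℓ²(ℤ^d)`; an isometric model of the Hilbert space `F_d(w)` via `f ↦ (w(k)·f̂(k))_k`.
Under this identification the embedding `I_d : F_d(w) → G` is characterized by the
property that the function `T c` has Fourier coefficients `c(k)/w(k)`. -/
abbrev ellTwo (d : ℕ) := lp (fun _ : ZLat d => ℂ) 2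

/-- `ℓ¹(ℤ^d)`; an isometric model of the Wiener algebra `A(𝕋^d)` via `f ↦ (f̂(k))_k`. -/
abbrev ellOne (d : ℕ) := lp (fun _ : ZLat d => ℂ) 1

/-- `ℓ^∞(ℤ^d)`; an isometric model of the space `ℬ(𝕋^d)` of distributions with bounded
Fourier coefficients. -/
abbrev ellInfty (d : ℕ) := lp (fun _ : ZLat d => ℂ) ⊤

/-- The weight `w^{mix}_{s,r}(k) = ∏_j (1+|k_j|^r)^{s/r}` of the Sobolev space of
dominating mixed smoothness `H^{s,r}_mix(𝕋^d) = F_d(w^{mix}_{s,r})`. -/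
def wMix (d : ℕ) (s r : ℝ) (k : ZLat d) : ℝ := ∏ j, (1 + |(k j : ℝ)| ^ r) ^ (s / r)

/-- The normalized measure on the torus is a product of normalized Haar measures. -/
theorem torusMeasure_eq_pi (d : ℕ) :
    torusMeasure d = Measure.pi fun _ : Fin d => (AddCircle.haarAddCircle (T := 2 * Real.pi)) := by
  refine (Measure.pi_eq fun t ht => ?_).symm
  have h0 : ENNReal.ofReal (2 * Real.pi) ≠ 0 := by
    simp [Real.pi_pos]
  rw [torusMeasure, Measure.smul_apply, Measure.pi_pi, smul_eq_mul]
  simp only [AddCircle.volume_eq_smul_haarAddCircle, Measure.smul_apply, smul_eq_mul,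
    Finset.prod_mul_distrib, Finset.prod_const, Finset.card_univ, Fintype.card_fin]
  rw [← mul_assoc, ← mul_pow, ENNReal.inv_mul_cancel h0 ENNReal.ofReal_ne_top, one_pow, one_mul]

instance isProbabilityMeasure_torusMeasure (d : ℕ) : IsProbabilityMeasure (torusMeasure d) := by
  rw [torusMeasure_eq_pi]
  infer_instance

/-- The character `torusChar k` as a continuous map. -/
def torusCharMap {d : ℕ} (k : ZLat d) : C(Torus d, ℂ) where
  toFun := torusChar k
  continuous_toFun := by unfold torusChar; fun_prop

theorem torusChar_neg {d : ℕ} (k : ZLat d) (x : Torus d) :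
    torusChar (-k) x = (starRingEnd ℂ) (torusChar k x) := by
  simp only [torusChar, Pi.neg_apply, fourier_neg, map_prod]

theorem torusChar_add {d : ℕ} (k l : ZLat d) (x : Torus d) :
    torusChar (k + l) x = torusChar k x * torusChar l x := by
  simp only [torusChar, Pi.add_apply, fourier_add, ← Finset.prod_mul_distrib]

theorem torusChar_zero {d : ℕ} (x : Torus d) : torusChar (0 : ZLat d) x = 1 := by
  simp [torusChar]

theorem torusChar_single {d : ℕ} (i : Fin d) (x : Torus d) :
    torusChar (Pi.single i 1) x = fourier 1 (x i) := by
  rw [torusChar, Finset.prod_eq_single i]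
  · simp
  · intro j _ hj
    simp [Pi.single_eq_of_ne hj]
  · simp

theorem norm_torusChar {d : ℕ} (k : ZLat d) (x : Torus d) : ‖torusChar k x‖ = 1 := by
  simp only [torusChar, norm_prod, fourier_apply, Circle.norm_coe, Finset.prod_const_one]

/-- The star subalgebra of continuous functions on the torus generated by the characters. -/
def torusCharSubalgebra (d : ℕ) : StarSubalgebra ℂ C(Torus d, ℂ) where
  toSubalgebra := Algebra.adjoin ℂ (Set.range torusCharMap)
  star_mem' := by
    change Algebra.adjoin ℂ (Set.range torusCharMap) ≤
      star (Algebra.adjoin ℂ (Set.range torusCharMap))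
    refine Algebra.adjoin_le ?_
    rintro _ ⟨n, rfl⟩
    refine Algebra.subset_adjoin ⟨-n, ?_⟩
    ext1 x
    exact torusChar_neg n x

theorem torusCharSubalgebra_coe (d : ℕ) :
    (torusCharSubalgebra d).toSubalgebra.toSubmodule =
      Submodule.span ℂ (Set.range torusCharMap) := by
  apply Algebra.adjoin_eq_span_of_subset
  refine .trans (fun x ↦ Submonoid.closure_induction (fun _ ↦ id) ⟨0, ?_⟩ ?_)
    Submodule.subset_span
  · ext x
    exact torusChar_zero x
  · rintro _ _ _ _ ⟨m, rfl⟩ ⟨n, rfl⟩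
    refine ⟨m + n, ?_⟩
    ext x
    exact torusChar_add m n x

theorem torusCharSubalgebra_separatesPoints (d : ℕ) :
    (torusCharSubalgebra d).SeparatesPoints := by
  intro x y hxy
  obtain ⟨i, hi⟩ := Function.ne_iff.mp hxy
  refine ⟨torusChar (Pi.single i 1),
    ⟨torusCharMap (Pi.single i 1), Algebra.subset_adjoin ⟨Pi.single i 1, rfl⟩, rfl⟩, ?_⟩
  rw [torusChar_single, torusChar_single, fourier_one, fourier_one]
  contrapose hi
  exact AddCircle.injective_toCircle (by positivity) (Circle.coe_injective hi)

theorem span_torusCharMap_closure_eq_top (d : ℕ) :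
    (Submodule.span ℂ (Set.range (torusCharMap (d := d)))).topologicalClosure = ⊤ := by
  rw [← torusCharSubalgebra_coe]
  exact congr_arg (Subalgebra.toSubmodule <| StarSubalgebra.toSubalgebra ·)
    (ContinuousMap.starSubalgebra_topologicalClosure_eq_top_of_separatesPoints _
      (torusCharSubalgebra_separatesPoints d))

/-- The characters as elements of `L²`. -/
def torusCharLp {d : ℕ} (k : ZLat d) : Lp ℂ 2 (torusMeasure d) :=
  ContinuousMap.toLp (E := ℂ) 2 (torusMeasure d) ℂ (torusCharMap k)

theorem coeFn_torusCharLp {d : ℕ} (k : ZLat d) :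
    torusCharLp k =ᵐ[torusMeasure d] torusChar k :=
  ContinuousMap.coeFn_toLp (torusMeasure d) (torusCharMap k)

theorem integral_torusChar {d : ℕ} {k : ZLat d} (hk : k ≠ 0) :
    ∫ x, torusChar k x ∂(torusMeasure d) = 0 := by
  simp only [torusMeasure_eq_pi, torusChar]
  rw [integral_fintype_prod_eq_prod]
  obtain ⟨i, hi⟩ := Function.ne_iff.mp hk
  apply Finset.prod_eq_zero (Finset.mem_univ i)
  exact integral_eq_zero_of_add_right_eq_neg (μ := AddCircle.haarAddCircle)
      (fourier_add_half_inv_index hi (by positivity))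

theorem orthonormal_torusCharLp (d : ℕ) : Orthonormal ℂ (torusCharLp (d := d)) := by
  rw [orthonormal_iff_ite]
  intro m n
  have h : inner ℂ (torusCharLp m) (torusCharLp n) =
      ∫ x, torusChar (n - m) x ∂(torusMeasure d) := by
    rw [torusCharLp, torusCharLp, ContinuousMap.inner_toLp]
    refine integral_congr_ae (.of_forall fun x => ?_)
    simp only [sub_eq_add_neg, torusChar_add, torusChar_neg]
    rfl
  rw [h]
  split_ifs with hmn
  · simp [hmn, torusChar_zero]
  · exact integral_torusChar (sub_ne_zero.mpr (Ne.symm hmn))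

theorem span_torusCharLp_closure_eq_top (d : ℕ) :
    (Submodule.span ℂ (Set.range (torusCharLp (d := d)))).topologicalClosure = ⊤ := by
  simpa only [Submodule.map_span, ContinuousLinearMap.coe_coe, ← Set.range_comp,
    Function.comp_def] using!
    (ContinuousMap.toLp_denseRange ℂ (torusMeasure d) ℂ
      (p := 2) (by simp)).topologicalClosure_map_submodule (span_torusCharMap_closure_eq_top d)

/-- The characters form a Hilbert basis of `L²` of the torus. -/
def torusBasis (d : ℕ) : HilbertBasis (ZLat d) ℂ (Lp ℂ 2 (torusMeasure d)) :=
  HilbertBasis.mk (orthonormal_torusCharLp d) (span_torusCharLp_closure_eq_top d).ge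

theorem fourierCoef_eq_inner {d : ℕ} (f : Lp ℂ 2 (torusMeasure d)) (k : ZLat d) :
    inner ℂ (torusCharLp k) f = fourierCoef f k := by
  rw [L2.inner_def, fourierCoef]
  refine integral_congr_ae ?_
  filter_upwards [coeFn_torusCharLp k] with x hx
  rw [hx, RCLike.inner_apply, mul_comm]

/-- Bounded functions on the torus are square integrable. -/
def linftyToL2 (d : ℕ) : Lp ℂ ⊤ (torusMeasure d) →ₗ[ℂ] Lp ℂ 2 (torusMeasure d) where
  toFun f := ⟨f.1, Lp.antitone le_top f.2⟩
  map_add' _ _ := rfl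
  map_smul' _ _ := rfl

theorem coeFn_linftyToL2 {d : ℕ} (f : Lp ℂ ⊤ (torusMeasure d)) :
    ⇑(linftyToL2 d f) = ⇑f := rfl

/-- A bounded function with a single nonzero Fourier coefficient is a multiple of a character. -/
theorem linftyToL2_eq_smul {d : ℕ} (f : Lp ℂ ⊤ (torusMeasure d)) (k : ZLat d) (a : ℂ)
    (hf : ∀ l, fourierCoef f l = if l = k then a else 0) :
    linftyToL2 d f = a • torusCharLp k := by
  apply (torusBasis d).repr.injective
  ext l
  simp only [HilbertBasis.repr_apply_apply]
  have hb : torusBasis d l = torusCharLp l := by simp [torusBasis]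
  rw [hb, fourierCoef_eq_inner, coeFn_linftyToL2, hf, inner_smul_right,
    orthonormal_iff_ite.mp (orthonormal_torusCharLp d)]
  simp

theorem norm_le_of_single_fourierCoef {d : ℕ} (f : Lp ℂ ⊤ (torusMeasure d)) (k : ZLat d) (a : ℂ)
    (hf : ∀ l, fourierCoef f l = if l = k then a else 0) : ‖f‖ ≤ ‖a‖ := by
  have h := linftyToL2_eq_smul f k a hf
  have h1 : ⇑f =ᵐ[torusMeasure d] fun x => a * torusChar k x := by
    rw [← coeFn_linftyToL2, h]
    filter_upwards [Lp.coeFn_smul a (torusCharLp k), coeFn_torusCharLp k] with x hx hy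
    rw [hx, Pi.smul_apply, hy, smul_eq_mul]
  have h2 : ∀ᵐ x ∂(torusMeasure d), ‖f x‖ ≤ ‖a‖ := by
    filter_upwards [h1] with x hx
    rw [hx, norm_mul, norm_torusChar, mul_one]
  simpa using Lp.norm_le_of_ae_bound (norm_nonneg a) h2

/-- The image of a unit vector under the embedding has a single nonzero Fourier coefficient. -/
theorem fourierCoef_embedding_single {d : ℕ} {w : ZLat d → ℝ}
    {T : ellTwo d →L[ℂ] Lp ℂ ⊤ (torusMeasure d)}
    (hT : ∀ (c : ellTwo d) (k : ZLat d), fourierCoef (⇑(T c)) k = c k / (w k : ℂ))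
    (k l : ZLat d) :
    fourierCoef (⇑(T (lp.single 2 k 1))) l = if l = k then ((w k)⁻¹ : ℂ) else 0 := by
  rw [hT]
  split_ifs with h
  · subst h
    simp
  · simp [h]

theorem norm_embedding_single_le {d : ℕ} {w : ZLat d → ℝ}
    {T : ellTwo d →L[ℂ] Lp ℂ ⊤ (torusMeasure d)}
    (hT : ∀ (c : ellTwo d) (k : ZLat d), fourierCoef (⇑(T c)) k = c k / (w k : ℂ))
    (k : ZLat d) : ‖T (lp.single 2 k 1)‖ ≤ |(w k)⁻¹| := by
  simpa using norm_le_of_single_fourierCoef _ k _ (fourierCoef_embedding_single hT k)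

theorem lp_single_eq_smul {d : ℕ} (c : ellTwo d) (k : ZLat d) :
    (lp.single 2 k (c k) : ellTwo d) = c k • lp.single 2 k 1 := by
  rw [← lp.single_smul]
  simp

/-- Truncating the Fourier series to a finite set of frequencies bounds the approximation
numbers from above by the `ℓ²` norm of the remaining inverse weights. -/
theorem approxNum_le_of_sum_le {d : ℕ} {w : ZLat d → ℝ}
    {T : ellTwo d →L[ℂ] Lp ℂ ⊤ (torusMeasure d)}
    (hT : ∀ (c : ellTwo d) (k : ZLat d), fourierCoef (⇑(T c)) k = c k / (w k : ℂ))
    {n : ℕ} {S : Finset (ZLat d)} (hS : S.card < n) {b : ℝ} (hb : 0 ≤ b)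
    (hw : ∀ F : Finset (ZLat d), Disjoint F S → ∑ k ∈ F, ((w k)⁻¹) ^ 2 ≤ b ^ 2) :
    approxNum T n ≤ b := by
  classical
  set A : ellTwo d →L[ℂ] Lp ℂ ⊤ (torusMeasure d) :=
    ∑ k ∈ S, (lp.evalCLM ℂ (fun _ : ZLat d => ℂ) 2 k).smulRight (T (lp.single 2 k 1)) with hA
  have hAapp : ∀ c : ellTwo d, A c = ∑ k ∈ S, c k • T (lp.single 2 k 1) := by
    intro c
    simp [hA, sum_apply]
    rfl
  have hrank : Module.rank ℂ (LinearMap.range (A : ellTwo d →ₗ[ℂ] Lp ℂ ⊤ (torusMeasure d))) <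
      n := by
    have hle : LinearMap.range (A : ellTwo d →ₗ[ℂ] Lp ℂ ⊤ (torusMeasure d)) ≤
        Submodule.span ℂ ((S.image fun k => T (lp.single 2 k 1) : Finset _) :
          Set (Lp ℂ ⊤ (torusMeasure d))) := by
      rintro _ ⟨c, rfl⟩
      rw [ContinuousLinearMap.coe_coe, hAapp]
      refine Submodule.sum_mem _ fun k hk => Submodule.smul_mem _ _ (Submodule.subset_span ?_)
      exact Finset.mem_coe.mpr (Finset.mem_image_of_mem _ hk)
    refine ((Submodule.rank_mono hle).trans (rank_span_finset_le _)).trans_lt ?_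
    exact_mod_cast Finset.card_image_le.trans_lt hS
  suffices h : ‖T - A‖ ≤ b by
    refine (csInf_le ⟨0, ?_⟩ ⟨A, hrank, rfl⟩ : approxNum T n ≤ ‖T - A‖).trans h
    rintro _ ⟨B, -, rfl⟩
    exact norm_nonneg _
  refine ContinuousLinearMap.opNorm_le_bound _ hb fun c => ?_
  have hsum : HasSum (fun k => c k • T (lp.single 2 k 1)) (T c) := by
    have h := T.hasSum (lp.hasSum_single (by simp) c)
    simpa only [lp_single_eq_smul, map_smul] using h
  have hlim : Tendsto (fun F : Finset (ZLat d) =>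
      (∑ k ∈ F, c k • T (lp.single 2 k 1)) - A c) atTop (nhds ((T - A) c)) :=
    hsum.sub_const (A c)
  refine le_of_tendsto hlim.norm ?_
  filter_upwards [eventually_ge_atTop S] with F hF
  have hdiff : (∑ k ∈ F, c k • T (lp.single 2 k 1)) - A c =
      ∑ k ∈ F \ S, c k • T (lp.single 2 k 1) := by
    rw [hAapp, ← Finset.sum_sdiff hF]
    simp
  rw [hdiff]
  calc ‖∑ k ∈ F \ S, c k • T (lp.single 2 k 1)‖
      ≤ ∑ k ∈ F \ S, |(w k)⁻¹| * ‖c k‖ := by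
        refine (norm_sum_le _ _).trans (Finset.sum_le_sum fun k _ => ?_)
        rw [norm_smul, mul_comm]
        exact mul_le_mul_of_nonneg_right (norm_embedding_single_le hT k) (norm_nonneg _)
    _ ≤ √(∑ k ∈ F \ S, |(w k)⁻¹| ^ 2) * √(∑ k ∈ F \ S, ‖c k‖ ^ 2) :=
        Real.sum_mul_le_sqrt_mul_sqrt _ _ _
    _ ≤ b * ‖c‖ := by
        refine mul_le_mul (Real.sqrt_le_left hb |>.mpr ?_)
          (Real.sqrt_le_left (norm_nonneg c) |>.mpr ?_) (Real.sqrt_nonneg _) hb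
        · simpa only [sq_abs] using hw _ Finset.sdiff_disjoint
        · have h := lp.sum_rpow_le_norm_rpow (p := 2) (by simp) c (F \ S)
          simpa using h

/-- A family of vectors that is close to a multiple of an orthonormal family cannot lie in a
space of small dimension. -/
theorem Orthonormal.exists_sum_sq_dist_ge {E ι : Type*} [NormedAddCommGroup E]
    [InnerProductSpace ℂ E] {χ : ι → E} (hχ : Orthonormal ℂ χ) (V : Submodule ℂ E)
    [FiniteDimensional ℂ V] (F : Finset ι) :
    ∃ q : ι → ℝ, (∀ k, 0 ≤ q k) ∧ (∀ k, q k ≤ 1) ∧ ∑ k ∈ F, q k ≤ Module.finrank ℂ V ∧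
      ∀ k, ∀ a : ℂ, ∀ v ∈ V, ‖a‖ ^ 2 * (1 - q k) ≤ ‖a • χ k - v‖ ^ 2 := by
  set b := stdOrthonormalBasis ℂ V
  have hb : Orthonormal ℂ (fun i => (b i : E)) :=
    b.orthonormal.comp_linearIsometry V.subtypeₗᵢ
  refine ⟨fun k => ‖V.starProjection (χ k)‖ ^ 2, fun k => sq_nonneg _, fun k => ?_, ?_, ?_⟩
  · have h1 : ‖V.starProjection (χ k)‖ ≤ 1 := by
      refine (V.norm_starProjection_apply_le (χ k)).trans (hχ.1 k).le
    exact pow_le_one₀ (norm_nonneg _) h1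
  · have hq : ∀ k, ‖V.starProjection (χ k)‖ ^ 2 = ∑ i, ‖inner ℂ (χ k) (b i : E)‖ ^ 2 := by
      intro k
      have h := b.sum_sq_norm_inner_right ⟨_, V.starProjection_apply_mem (χ k)⟩
      rw [Submodule.coe_norm] at h
      rw [← h]
      refine Finset.sum_congr rfl fun i _ => ?_
      rw [Submodule.coe_inner, ← Submodule.inner_starProjection_left_eq_right,
        Submodule.starProjection_eq_self_iff.mpr (b i).2, norm_inner_symm]
    simp only [hq]
    rw [Finset.sum_comm]
    calc ∑ i, ∑ k ∈ F, ‖inner ℂ (χ k) (b i : E)‖ ^ 2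
        ≤ ∑ i, ‖(b i : E)‖ ^ 2 := Finset.sum_le_sum fun i _ => hχ.sum_inner_products_le _
      _ = Module.finrank ℂ V := by simp [hb.1]
  · intro k a v hv
    have h1 := Submodule.norm_sq_eq_add_norm_sq_starProjection (χ k) V
    have h2 := Submodule.norm_sq_eq_add_norm_sq_starProjection (a • χ k - v) V
    have h3 : Vᗮ.starProjection v = 0 := by
      rw [Submodule.starProjection_apply_eq_zero_iff, Submodule.orthogonal_orthogonal]
      exact hv
    rw [hχ.1 k] at h1
    rw [h2, map_sub Vᗮ.starProjection, h3, sub_zero, map_smul, norm_smul]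
    nlinarith [sq_nonneg ‖V.starProjection (a • χ k - v)‖]

theorem ae_norm_le_norm_of_linfty {α : Type*} [MeasurableSpace α] {μ : Measure α}
    (f : Lp ℂ ⊤ μ) : ∀ᵐ x ∂μ, ‖f x‖ ≤ ‖f‖ := by
  filter_upwards [ae_le_eLpNormEssSup (f := f) (μ := μ)] with x hx
  rw [Lp.norm_def, ← toReal_enorm, eLpNorm_exponent_top]
  refine ENNReal.toReal_mono ?_ hx
  rw [← eLpNorm_exponent_top]
  exact Lp.eLpNorm_ne_top f

/-- If the operator maps into bounded functions, then the pointwise sum of squares of the images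
of an orthonormal family is bounded by the squared operator norm. -/
theorem ae_sum_sq_le_opNorm_sq {d : ℕ} (B : ellTwo d →L[ℂ] Lp ℂ ⊤ (torusMeasure d))
    (F : Finset (ZLat d)) :
    ∀ᵐ x ∂(torusMeasure d), ∑ k ∈ F, ‖B (lp.single 2 k 1) x‖ ^ 2 ≤ ‖B‖ ^ 2 := by
  classical
  have hae : ∀ a : ZLat d → ℂ, ∀ᵐ x ∂(torusMeasure d),
      ‖∑ k ∈ F, a k * B (lp.single 2 k 1) x‖ ≤ ‖B‖ * √(∑ k ∈ F, ‖a k‖ ^ 2) := by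
    intro a
    set c : ellTwo d := ∑ k ∈ F, lp.single 2 k (a k) with hc
    have hBc : B c = ∑ k ∈ F, a k • B (lp.single 2 k 1) := by
      rw [hc, map_sum]
      refine Finset.sum_congr rfl fun k _ => ?_
      rw [← map_smul, ← lp.single_smul, smul_eq_mul, mul_one]
    have hnc : ‖c‖ = √(∑ k ∈ F, ‖a k‖ ^ 2) := by
      have h := lp.norm_sum_single (E := fun _ : ZLat d => ℂ) (p := 2) (by simp) a F
      have h' : ‖c‖ ^ 2 = ∑ k ∈ F, ‖a k‖ ^ 2 := by simpa using h
      rw [← h', Real.sqrt_sq (norm_nonneg _)]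
    have h2 : ⇑(B c) =ᵐ[torusMeasure d] fun x => ∑ k ∈ F, a k * B (lp.single 2 k 1) x := by
      rw [hBc]
      have h3 : ∀ᵐ x ∂(torusMeasure d), ∀ k : ZLat d,
          (a k • B (lp.single 2 k 1)) x = a k * B (lp.single 2 k 1) x := by
        rw [ae_all_iff]
        intro k
        filter_upwards [Lp.coeFn_smul (a k) (B (lp.single 2 k 1))] with x hx
        rw [hx, Pi.smul_apply, smul_eq_mul]
      filter_upwards [h3, Lp.coeFn_finsetSum F (fun k => a k • B (lp.single 2 k 1))]
        with x hx hy
      rw [hy, Finset.sum_apply]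
      exact Finset.sum_congr rfl fun k _ => hx k
    filter_upwards [ae_norm_le_norm_of_linfty (B c), h2] with x hx hy
    rw [← hy, ← hnc]
    exact hx.trans (B.le_opNorm c)
  have hdense := TopologicalSpace.denseRange_denseSeq (ZLat d → ℂ)
  filter_upwards [ae_all_iff.mpr fun m => hae (TopologicalSpace.denseSeq (ZLat d → ℂ) m)]
    with x hx
  have hall : ∀ a : ZLat d → ℂ,
      ‖∑ k ∈ F, a k * B (lp.single 2 k 1) x‖ ≤ ‖B‖ * √(∑ k ∈ F, ‖a k‖ ^ 2) := by
    intro a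
    refine hdense.induction_on (p := fun a : ZLat d → ℂ =>
      ‖∑ k ∈ F, a k * B (lp.single 2 k 1) x‖ ≤ ‖B‖ * √(∑ k ∈ F, ‖a k‖ ^ 2)) a ?_ hx
    exact isClosed_le (by fun_prop) (by fun_prop)
  have h := hall fun k => (starRingEnd ℂ) (B (lp.single 2 k 1) x)
  simp only [Complex.conj_mul', RCLike.norm_conj] at h
  norm_cast at h
  set t := ∑ k ∈ F, ‖B (lp.single 2 k 1) x‖ ^ 2 with ht
  have ht0 : 0 ≤ t := by positivity
  rw [Real.norm_of_nonneg ht0] at h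
  have hle : √t ≤ ‖B‖ := by
    rcases (Real.sqrt_nonneg t).eq_or_lt with h0 | h0
    · rw [← h0]; positivity
    · nlinarith [Real.mul_self_sqrt ht0]
  rw [← Real.sq_sqrt ht0]
  exact pow_le_pow_left₀ (Real.sqrt_nonneg t) hle 2

theorem norm_linftyToL2_sq {d : ℕ} (f : Lp ℂ ⊤ (torusMeasure d)) :
    ‖linftyToL2 d f‖ ^ 2 = ∫ x, ‖f x‖ ^ 2 ∂(torusMeasure d) := by
  rw [← @inner_self_eq_norm_sq ℂ, L2.inner_def]
  simp only [coeFn_linftyToL2, inner_self_eq_norm_sq_to_K]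
  norm_cast

/-- A lower bound for the error of approximation by operators of small rank, in terms of the
inverse weights on a finite set of frequencies. -/
theorem exists_sum_le_norm_sub_sq {d : ℕ} {w : ZLat d → ℝ}
    {T : ellTwo d →L[ℂ] Lp ℂ ⊤ (torusMeasure d)}
    (hT : ∀ (c : ellTwo d) (k : ZLat d), fourierCoef (⇑(T c)) k = c k / (w k : ℂ))
    {n : ℕ} {A : ellTwo d →L[ℂ] Lp ℂ ⊤ (torusMeasure d)}
    (hA : Module.rank ℂ (LinearMap.range (A : ellTwo d →ₗ[ℂ] Lp ℂ ⊤ (torusMeasure d))) < n)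
    (F : Finset (ZLat d)) :
    ∃ q : ZLat d → ℝ, (∀ k, 0 ≤ q k) ∧ (∀ k, q k ≤ 1) ∧ ∑ k ∈ F, q k ≤ (n : ℝ) - 1 ∧
      ∑ k ∈ F, ((w k)⁻¹) ^ 2 * (1 - q k) ≤ ‖T - A‖ ^ 2 := by
  set V := (LinearMap.range (A : ellTwo d →ₗ[ℂ] Lp ℂ ⊤ (torusMeasure d))).map (linftyToL2 d)
  have hV : Module.rank ℂ V < n := (rank_map_le _ _).trans_lt hA
  have : FiniteDimensional ℂ V :=
    Module.rank_lt_aleph0_iff.mp (hV.trans Cardinal.natCast_lt_aleph0)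
  have hVn : Module.finrank ℂ V < n := by
    rw [← Module.finrank_eq_rank] at hV
    exact_mod_cast hV
  obtain ⟨q, hq0, hq1, hqs, hq⟩ :=
    (orthonormal_torusCharLp d).exists_sum_sq_dist_ge V F
  refine ⟨q, hq0, hq1, hqs.trans ?_, ?_⟩
  · have : (Module.finrank ℂ V : ℝ) + 1 ≤ n := by exact_mod_cast hVn
    linarith
  have hterm : ∀ k, ((w k)⁻¹) ^ 2 * (1 - q k) ≤
      ∫ x, ‖(T - A) (lp.single 2 k 1) x‖ ^ 2 ∂(torusMeasure d) := by
    intro k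
    rw [← norm_linftyToL2_sq, sub_apply, map_sub,
      linftyToL2_eq_smul _ k _ (fourierCoef_embedding_single hT k)]
    refine le_trans (le_of_eq ?_) (hq k ((w k)⁻¹ : ℂ) _ ⟨_, ⟨lp.single 2 k 1, rfl⟩, rfl⟩)
    simp
  have h_int : ∀ k, Integrable (fun x => ‖(T - A) (lp.single 2 k 1) x‖ ^ 2) (torusMeasure d) := by
    intro k
    exact ((Lp.memLp ((T - A) (lp.single 2 k 1))).mono_exponent le_top).integrable_norm_pow
      two_ne_zero
  calc ∑ k ∈ F, ((w k)⁻¹) ^ 2 * (1 - q k)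
      ≤ ∑ k ∈ F, ∫ x, ‖(T - A) (lp.single 2 k 1) x‖ ^ 2 ∂(torusMeasure d) :=
        Finset.sum_le_sum fun k _ => hterm k
    _ = ∫ x, ∑ k ∈ F, ‖(T - A) (lp.single 2 k 1) x‖ ^ 2 ∂(torusMeasure d) :=
        (integral_finsetSum F fun k _ => h_int k).symm
    _ ≤ ∫ _, ‖T - A‖ ^ 2 ∂(torusMeasure d) :=
        integral_mono_ae (integrable_finsetSum F fun k _ => h_int k) (integrable_const _)
          (ae_sum_sq_le_opNorm_sq (T - A) F)
    _ = ‖T - A‖ ^ 2 := by simp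

/-- The lattice points of the cube of side `2M`, with `∏ v(k_j) ≤ R`. -/
def hyperbolicCross (v : ℤ → ℝ) (M d : ℕ) (R : ℝ) : Finset (ZLat d) :=
  (Fintype.piFinset fun _ : Fin d => Finset.Icc (-(M : ℤ)) M).filter fun k => ∏ j, v (k j) ≤ R

theorem card_hyperbolicCross_succ {v : ℤ → ℝ} (hv : ∀ a, 0 < v a) (M d : ℕ) (R : ℝ) :
    (hyperbolicCross v M (d + 1) R).card =
      ∑ a ∈ Finset.Icc (-(M : ℤ)) M, (hyperbolicCross v M d (R / v a)).card := by
  rw [← Finset.card_sigma]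
  refine Finset.card_nbij' (fun k => ⟨k 0, Fin.tail k⟩) (fun p => Fin.cons p.1 p.2) ?_ ?_ ?_ ?_
  · intro k hk
    simp only [hyperbolicCross, Finset.coe_filter, Fintype.mem_piFinset, Set.mem_ofPred_eq,
      Finset.coe_sigma, Set.mem_sigma_iff, Fin.prod_univ_succ, Finset.mem_coe] at hk ⊢
    refine ⟨hk.1 0, fun j => hk.1 j.succ, ?_⟩
    rw [le_div_iff₀' (hv _)]
    exact hk.2
  · rintro ⟨a, k⟩ hk
    simp only [hyperbolicCross, Finset.coe_filter, Fintype.mem_piFinset, Set.mem_ofPred_eq,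
      Finset.coe_sigma, Set.mem_sigma_iff, Fin.prod_univ_succ, Finset.mem_coe,
      Fin.forall_fin_succ, Fin.cons_zero, Fin.cons_succ] at hk ⊢
    refine ⟨⟨hk.1, hk.2.1⟩, ?_⟩
    rw [← le_div_iff₀' (hv _)]
    exact hk.2.2
  · intro k _
    exact Fin.cons_self_tail k
  · rintro ⟨a, k⟩ _
    simp [Fin.tail_cons]

theorem card_hyperbolicCross_zero {v : ℤ → ℝ} (M : ℕ) {R : ℝ} (hR : 1 ≤ R) :
    (hyperbolicCross v M 0 R).card = 1 := by
  simp [hyperbolicCross, hR]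

theorem hyperbolicCross_eq_empty {v : ℤ → ℝ} (hv : ∀ a, 1 ≤ v a) (M d : ℕ) {R : ℝ} (hR : R < 1) :
    hyperbolicCross v M d R = ∅ := by
  refine Finset.filter_eq_empty_iff.mpr fun k _ => not_le.mpr (hR.trans_le ?_)
  exact Finset.one_le_prod fun j _ => hv (k j)

theorem sum_Icc_neg_eq (f : ℤ → ℝ) (hf : ∀ a, f (-a) = f a) (M : ℕ) :
    ∑ a ∈ Finset.Icc (-(M : ℤ)) M, f a = f 0 + 2 * ∑ m ∈ Finset.range M, f (m + 1) := by
  induction M with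
  | zero => simp
  | succ M ih =>
    have h : Finset.Icc (-((M + 1 : ℕ) : ℤ)) ((M + 1 : ℕ) : ℤ) =
        insert (-((M : ℤ) + 1)) (insert ((M : ℤ) + 1) (Finset.Icc (-(M : ℤ)) M)) := by
      ext a
      simp only [Finset.mem_Icc, Finset.mem_insert]
      push_cast
      omega
    rw [h, Finset.sum_insert, Finset.sum_insert, ih, Finset.sum_range_succ, hf]
    · ring
    · simp
    · simp only [Finset.mem_insert, Finset.mem_Icc]
      omega

theorem sum_range_le_sum_Icc_neg {f : ℤ → ℝ} (hf : ∀ a, 0 ≤ f a) (M : ℕ) :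
    ∑ m ∈ Finset.range (M + 1), f m ≤ ∑ a ∈ Finset.Icc (-(M : ℤ)) M, f a := by
  rw [← Finset.sum_image (s := Finset.range (M + 1)) (g := fun m : ℕ => (m : ℤ)) (f := f)
    (fun a _ b _ h => by simpa using h)]
  refine Finset.sum_le_sum_of_subset_of_nonneg ?_ fun a _ _ => hf a
  intro a ha
  obtain ⟨m, hm, rfl⟩ := Finset.mem_image.mp ha
  rw [Finset.mem_range] at hm
  rw [Finset.mem_Icc]
  omega

theorem mul_pow_mul_sub_le_pow_sub_pow {x y : ℝ} (hx : 0 ≤ x) (hxy : x ≤ y) (i : ℕ) :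
    (i + 1) * (x ^ i * (y - x)) ≤ y ^ (i + 1) - x ^ (i + 1) := by
  have hy : 0 ≤ y := hx.trans hxy
  rw [← (Commute.all y x).geom_sum₂_mul]
  rw [← mul_assoc]
  refine mul_le_mul_of_nonneg_right ?_ (sub_nonneg.mpr hxy)
  calc ((i : ℝ) + 1) * x ^ i = ∑ j ∈ Finset.range (i + 1), x ^ j * x ^ (i + 1 - 1 - j) := by
        rw [Finset.sum_congr rfl (g := fun _ => x ^ i)]
        · simp
        · intro j hj
          rw [Finset.mem_range] at hj
          rw [← pow_add]
          congr 1
          omega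
    _ ≤ _ := Finset.sum_le_sum fun j _ => by gcongr

theorem pow_sub_pow_le_mul_pow_mul_sub {x y : ℝ} (hx : 0 ≤ x) (hxy : x ≤ y) (i : ℕ) :
    y ^ (i + 1) - x ^ (i + 1) ≤ (i + 1) * (y ^ i * (y - x)) := by
  have hy : 0 ≤ y := hx.trans hxy
  rw [← (Commute.all y x).geom_sum₂_mul]
  rw [← mul_assoc]
  refine mul_le_mul_of_nonneg_right ?_ (sub_nonneg.mpr hxy)
  calc _ ≤ ∑ j ∈ Finset.range (i + 1), y ^ j * y ^ (i + 1 - 1 - j) :=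
        Finset.sum_le_sum fun j _ => by gcongr
    _ = ((i : ℝ) + 1) * y ^ i := by
        rw [Finset.sum_congr rfl (g := fun _ => y ^ i)]
        · simp
        · intro j hj
          rw [Finset.mem_range] at hj
          rw [← pow_add]
          congr 1
          omega

theorem sum_log_pow_div_le {R : ℝ} (hR : 1 ≤ R) (i M : ℕ) :
    ∑ m ∈ Finset.range M, (if ((m : ℝ) + 2) ≤ R then
      Real.log (R / (m + 2)) ^ i / (m + 2) else 0) ≤ Real.log R ^ (i + 1) / (i + 1) := by
  set y : ℕ → ℝ := fun m => max (Real.log (R / (m + 1))) 0 with hy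
  have hstep : ∀ m : ℕ, (if ((m : ℝ) + 2) ≤ R then
      Real.log (R / (m + 2)) ^ i / (m + 2) else 0) ≤
      (y m ^ (i + 1) - y (m + 1) ^ (i + 1)) / (i + 1) := by
    intro m
    have hm : (0 : ℝ) < m + 1 := by positivity
    have hlog : Real.log (R / (m + 1)) - Real.log (R / (m + 2)) ≥ 1 / (m + 2) := by
      rw [Real.log_div (by positivity) (by positivity), Real.log_div (by positivity)
        (by positivity)]
      have h := Real.one_sub_inv_le_log_of_pos (x := ((m : ℝ) + 2) / (m + 1)) (by positivity)
      rw [Real.log_div (by positivity) (by positivity)] at h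
      have h2 : 1 - (((m : ℝ) + 2) / (m + 1))⁻¹ = 1 / (m + 2) := by field_simp; ring
      linarith
    have hpos : (0 : ℝ) < 1 / (m + 2) := by positivity
    have hy1 : y (m + 1) = max (Real.log (R / (m + 2))) 0 := by
      simp only [hy]
      push_cast
      ring_nf
    have hle : y (m + 1) ≤ y m := by
      rw [hy1]
      exact max_le_max_right _ (by linarith)
    have h0 : 0 ≤ y (m + 1) := by rw [hy1]; exact le_max_right _ _
    split_ifs with h
    · have h1 : 0 ≤ Real.log (R / (m + 2)) := Real.log_nonneg ((one_le_div (by positivity)).mpr h)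
      have hy2 : y (m + 1) = Real.log (R / (m + 2)) := by rw [hy1, max_eq_left h1]
      have hd : 1 / (m + 2) ≤ y m - y (m + 1) := by
        rw [hy2]
        have := le_max_left (Real.log (R / (m + 1))) 0
        simp only [hy]
        linarith
      rw [le_div_iff₀ (by positivity)]
      refine le_trans ?_ (mul_pow_mul_sub_le_pow_sub_pow h0 hle i)
      rw [← hy2, mul_comm, div_eq_mul_one_div]
      gcongr
    · have := pow_le_pow_left₀ h0 hle (i + 1)
      exact div_nonneg (by linarith) (by positivity)
  refine (Finset.sum_le_sum fun m _ => hstep m).trans ?_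
  rw [← Finset.sum_div, Finset.sum_range_sub']
  have hy0 : y 0 = Real.log R := by
    simp [hy, Real.log_nonneg hR]
  have : 0 ≤ y M ^ (i + 1) := by
    have : 0 ≤ y M := le_max_right _ _
    positivity
  rw [hy0]
  gcongr
  linarith

theorem choose_sum_step (d : ℕ) (L : ℝ) :
    (∑ i ∈ Finset.range (d + 1), (d.choose i : ℝ) * 2 ^ i * (L ^ i / (i.factorial : ℝ))) +
      2 * ∑ i ∈ Finset.range (d + 1), (d.choose i : ℝ) * 2 ^ i *
        (L ^ (i + 1) / ((i + 1) * (i.factorial : ℝ))) =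
    ∑ i ∈ Finset.range (d + 2), ((d + 1).choose i : ℝ) * 2 ^ i * (L ^ i / (i.factorial : ℝ)) := by
  rw [Finset.sum_range_succ' _ (d + 1)]
  rw [Finset.sum_range_succ' (fun i => (d.choose i : ℝ) * 2 ^ i * (L ^ i / (i.factorial : ℝ))) d]
  have h : ∑ i ∈ Finset.range d, (d.choose (i + 1) : ℝ) * 2 ^ (i + 1) *
      (L ^ (i + 1) / ((i + 1).factorial : ℝ)) = ∑ i ∈ Finset.range (d + 1),
      (d.choose (i + 1) : ℝ) * 2 ^ (i + 1) * (L ^ (i + 1) / ((i + 1).factorial : ℝ)) := by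
    rw [Finset.sum_range_succ]
    simp
  rw [h, Finset.mul_sum]
  rw [add_right_comm, ← Finset.sum_add_distrib]
  congr 1
  · refine Finset.sum_congr rfl fun i _ => ?_
    rw [Nat.choose_succ_succ, Nat.factorial_succ]
    push_cast
    ring
  · simp

/-- An upper bound for the number of lattice points in a hyperbolic cross. -/
theorem card_hyperbolicCross_le (d M : ℕ) {R : ℝ} (hR : 1 ≤ R) :
    ((hyperbolicCross (fun a => 1 + |(a : ℝ)|) M (d + 1) R).card : ℝ) ≤
      2 * R * ∑ i ∈ Finset.range (d + 1),
        (d.choose i : ℝ) * 2 ^ i * (Real.log R ^ i / (i.factorial : ℝ)) := by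
  set v : ℤ → ℝ := fun a => 1 + |(a : ℝ)| with hv
  have hv1 : ∀ a, 1 ≤ v a := fun a => by simp [hv]
  have hv0 : ∀ a, 0 < v a := fun a => zero_lt_one.trans_le (hv1 a)
  have hvm : ∀ m : ℕ, v ((m : ℤ) + 1) = m + 2 := by
    intro m
    simp only [hv]
    push_cast
    rw [abs_of_nonneg (by positivity)]
    ring
  have hrec : ∀ (e : ℕ) (R : ℝ), ((hyperbolicCross v M (e + 1) R).card : ℝ) =
      ((hyperbolicCross v M e R).card : ℝ) +
        2 * ∑ m ∈ Finset.range M, ((hyperbolicCross v M e (R / (m + 2))).card : ℝ) := by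
    intro e R
    rw [card_hyperbolicCross_succ hv0]
    push_cast
    rw [sum_Icc_neg_eq (fun a => ((hyperbolicCross v M e (R / v a)).card : ℝ))
      (fun a => by simp [hv])]
    simp only [hvm]
    simp [hv]
  induction d generalizing R with
  | zero =>
    rw [hrec, card_hyperbolicCross_zero M hR]
    have hle : ∀ m ∈ Finset.range M, ((hyperbolicCross v M 0 (R / (m + 2))).card : ℝ) ≤
        if m ∈ Finset.range (⌊R⌋₊ - 1) then 1 else 0 := by
      intro m _
      by_cases h : R / (m + 2) < 1
      · rw [hyperbolicCross_eq_empty hv1 M 0 h]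
        split_ifs <;> simp
      · rw [not_lt] at h
        rw [card_hyperbolicCross_zero M h, if_pos]
        · simp
        · rw [one_le_div (by positivity)] at h
          have : m + 2 ≤ ⌊R⌋₊ := Nat.le_floor (by push_cast; exact h)
          rw [Finset.mem_range]
          omega
    have h1 : ∑ m ∈ Finset.range M, ((hyperbolicCross v M 0 (R / (m + 2))).card : ℝ) ≤ R - 1 := by
      refine (Finset.sum_le_sum hle).trans ?_
      rw [Finset.sum_ite_mem, Finset.sum_const, nsmul_eq_mul, mul_one]
      have h2 : (Finset.range M ∩ Finset.range (⌊R⌋₊ - 1)).card ≤ ⌊R⌋₊ - 1 :=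
        (Finset.card_le_card Finset.inter_subset_right).trans (by simp)
      have h3 : 1 ≤ ⌊R⌋₊ := Nat.le_floor (by simpa using hR)
      have h4 : (((⌊R⌋₊ - 1 : ℕ)) : ℝ) = (⌊R⌋₊ : ℝ) - 1 := by push_cast [h3]; ring
      have h5 : (⌊R⌋₊ : ℝ) ≤ R := Nat.floor_le (by linarith)
      calc _ ≤ (((⌊R⌋₊ - 1 : ℕ)) : ℝ) := by exact_mod_cast h2
        _ ≤ R - 1 := by linarith
    simp
    linarith
  | succ d ih =>
    rw [hrec, ← choose_sum_step]
    have hterm : ∀ m ∈ Finset.range M, ((hyperbolicCross v M (d + 1) (R / (m + 2))).card : ℝ) ≤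
        2 * R * ∑ i ∈ Finset.range (d + 1), (d.choose i : ℝ) * 2 ^ i / (i.factorial : ℝ) *
          (if ((m : ℝ) + 2) ≤ R then Real.log (R / (m + 2)) ^ i / (m + 2) else 0) := by
      intro m _
      split_ifs with h
      · refine (ih ((one_le_div (by positivity)).mpr h)).trans (le_of_eq ?_)
        rw [Finset.mul_sum, Finset.mul_sum]
        refine Finset.sum_congr rfl fun i _ => ?_
        ring
      · rw [hyperbolicCross_eq_empty hv1 M _ ((div_lt_one (by positivity)).mpr (not_le.mp h))]
        simp
    have hsum := Finset.sum_le_sum hterm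
    rw [← Finset.mul_sum, Finset.sum_comm] at hsum
    simp only [← Finset.mul_sum] at hsum
    have hlog : ∑ i ∈ Finset.range (d + 1), (d.choose i : ℝ) * 2 ^ i / (i.factorial : ℝ) *
        ∑ m ∈ Finset.range M, (if ((m : ℝ) + 2) ≤ R then
          Real.log (R / (m + 2)) ^ i / (m + 2) else 0) ≤
        ∑ i ∈ Finset.range (d + 1), (d.choose i : ℝ) * 2 ^ i *
        (Real.log R ^ (i + 1) / ((i + 1) * (i.factorial : ℝ))) := by
      refine Finset.sum_le_sum fun i _ => ?_
      refine (mul_le_mul_of_nonneg_left (sum_log_pow_div_le hR i M) (by positivity)).trans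
        (le_of_eq ?_)
      field_simp
    have h2 := mul_le_mul_of_nonneg_left hlog (by linarith : 0 ≤ 2 * R)
    have h3 := ih hR
    linarith

theorem sqrt_one_add_sq_succ_le (x : ℝ) :
    √(1 + (x + 1) ^ 2) ≤ √(1 + x ^ 2) + 1 := by
  rw [Real.sqrt_le_left (by positivity)]
  have h1 : x ≤ √(1 + x ^ 2) := Real.le_sqrt_of_sq_le (by linarith)
  have h2 := Real.sq_sqrt (by positivity : (0 : ℝ) ≤ 1 + x ^ 2)
  nlinarith

theorem one_le_sqrt_one_add_sq (x : ℝ) : 1 ≤ √(1 + x ^ 2) :=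
  Real.one_le_sqrt.mpr (by linarith [sq_nonneg x])

theorem le_sum_log_pow_div {R : ℝ} (hR : 1 ≤ R) (i : ℕ) {M : ℕ} (hM : R ≤ M) :
    Real.log R ^ (i + 1) / (i + 1) ≤ ∑ m ∈ Finset.range (M + 1),
      (if √(1 + (m : ℝ) ^ 2) ≤ R then
        Real.log (R / √(1 + (m : ℝ) ^ 2)) ^ i / √(1 + (m : ℝ) ^ 2) else 0) := by
  set u : ℕ → ℝ := fun m => √(1 + (m : ℝ) ^ 2) with hu
  have hu1 : ∀ m, 1 ≤ u m := fun m => one_le_sqrt_one_add_sq _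
  have hu0 : ∀ m, 0 < u m := fun m => zero_lt_one.trans_le (hu1 m)
  have hus : ∀ m, u (m + 1) ≤ u m + 1 := fun m => by
    simpa [hu] using sqrt_one_add_sq_succ_le (m : ℝ)
  have hum : ∀ m, u m ≤ u (m + 1) := fun m => by
    simp only [hu]
    push_cast
    gcongr
    simp
  set y : ℕ → ℝ := fun m => max (Real.log (R / u m)) 0 with hy
  have hy0 : ∀ m, 0 ≤ y m := fun m => le_max_right _ _
  have hlog : ∀ m, Real.log (R / u m) - Real.log (R / u (m + 1)) ≤ 1 / u m := by
    intro m
    rw [Real.log_div (by positivity) (hu0 _).ne', Real.log_div (by positivity) (hu0 _).ne']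
    have h := Real.log_le_sub_one_of_pos (div_pos (hu0 (m + 1)) (hu0 m))
    rw [Real.log_div (hu0 _).ne' (hu0 _).ne'] at h
    have h2 : u (m + 1) / u m - 1 ≤ 1 / u m := by
      rw [div_sub_one (hu0 m).ne']
      exact div_le_div_of_nonneg_right (by linarith [hus m]) (hu0 m).le
    linarith
  have hle : ∀ m, y (m + 1) ≤ y m := fun m => by
    refine max_le_max_right _ (Real.log_le_log (div_pos (by linarith) (hu0 _)) ?_)
    exact div_le_div_of_nonneg_left (by linarith) (hu0 m) (hum m)
  have hstep : ∀ m : ℕ, (y m ^ (i + 1) - y (m + 1) ^ (i + 1)) / (i + 1) ≤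
      (if u m ≤ R then Real.log (R / u m) ^ i / u m else 0) := by
    intro m
    split_ifs with h
    · have h1 : 0 ≤ Real.log (R / u m) := Real.log_nonneg ((one_le_div (hu0 m)).mpr h)
      have hy2 : y m = Real.log (R / u m) := max_eq_left h1
      have hd : y m - y (m + 1) ≤ 1 / u m := by
        have := le_max_left (Real.log (R / u (m + 1))) 0
        have := hlog m
        rw [hy2]
        simp only [hy]
        linarith
      rw [div_le_iff₀ (by positivity), mul_comm _ ((i : ℝ) + 1)]
      refine (pow_sub_pow_le_mul_pow_mul_sub (hy0 _) (hle m) i).trans ?_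
      rw [← hy2, div_eq_mul_one_div (y m ^ i)]
      have := pow_nonneg (hy0 m) i
      gcongr
    · have h1 : y m = 0 := max_eq_right (Real.log_nonpos (div_nonneg (by linarith) (hu0 m).le)
        ((div_le_one (hu0 m)).mpr (not_le.mp h).le))
      have h2 : y (m + 1) = 0 := le_antisymm (h1 ▸ hle m) (hy0 _)
      simp [h1, h2]
  refine le_trans ?_ (Finset.sum_le_sum fun m _ => hstep m)
  rw [← Finset.sum_div, Finset.sum_range_sub']
  have hy00 : y 0 = Real.log R := by simp [hy, hu, Real.log_nonneg hR]
  have hyM : y (M + 1) = 0 := by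
    refine max_eq_right (Real.log_nonpos (div_nonneg (by linarith) (hu0 _).le)
        ((div_le_one (hu0 _)).mpr ?_))
    refine Real.le_sqrt_of_sq_le ?_
    push_cast
    have : (0 : ℝ) ≤ M := by positivity
    nlinarith
  rw [hy00, hyM]
  simp

/-- A lower bound for the number of lattice points in a hyperbolic cross. -/
theorem le_card_hyperbolicCross (d : ℕ) {M : ℕ} {R : ℝ} (hR : 1 ≤ R) (hM : R ≤ M) :
    R * Real.log R ^ d / (√2 * (d.factorial : ℝ)) ≤
      ((hyperbolicCross (fun a => √(1 + (a : ℝ) ^ 2)) M (d + 1) R).card : ℝ) := by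
  set v : ℤ → ℝ := fun a => √(1 + (a : ℝ) ^ 2) with hv
  have hv1 : ∀ a, 1 ≤ v a := fun a => one_le_sqrt_one_add_sq _
  have hv0 : ∀ a, 0 < v a := fun a => zero_lt_one.trans_le (hv1 a)
  have hvm : ∀ m : ℕ, v (m : ℤ) = √(1 + (m : ℝ) ^ 2) := fun m => by simp [hv]
  have hrec : ∀ (e : ℕ) (R : ℝ), ∑ m ∈ Finset.range (M + 1),
      ((hyperbolicCross v M e (R / √(1 + (m : ℝ) ^ 2))).card : ℝ) ≤
        ((hyperbolicCross v M (e + 1) R).card : ℝ) := by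
    intro e R
    rw [card_hyperbolicCross_succ hv0]
    push_cast
    refine le_trans (le_of_eq ?_) (sum_range_le_sum_Icc_neg
      (f := fun a => ((hyperbolicCross v M e (R / v a)).card : ℝ)) (fun a => by positivity) M)
    exact Finset.sum_congr rfl fun m _ => by rw [hvm]
  induction d generalizing R with
  | zero =>
    refine le_trans ?_ (hrec 0 R)
    set m₀ := ⌊√(R ^ 2 - 1)⌋₊ with hm₀
    have hR2 : 0 ≤ R ^ 2 - 1 := by nlinarith
    have hfl : (m₀ : ℝ) ≤ √(R ^ 2 - 1) := Nat.floor_le (Real.sqrt_nonneg _)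
    have hlt : √(R ^ 2 - 1) < m₀ + 1 := Nat.lt_floor_add_one _
    have hsq := Real.sq_sqrt hR2
    have hm₀M : m₀ ≤ M := by
      have h1 : √(R ^ 2 - 1) ≤ R := Real.sqrt_le_left (by linarith) |>.mpr (by linarith)
      exact_mod_cast hfl.trans (h1.trans hM)
    have hone : ∀ m ∈ Finset.range (m₀ + 1),
        ((hyperbolicCross v M 0 (R / √(1 + (m : ℝ) ^ 2))).card : ℝ) = 1 := by
      intro m hm
      rw [Finset.mem_range, Nat.lt_succ_iff] at hm
      rw [card_hyperbolicCross_zero M, Nat.cast_one]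
      have h0 := hv0 m
      rw [hvm] at h0
      rw [one_le_div h0, Real.sqrt_le_left (by linarith)]
      have h1 : (m : ℝ) ≤ √(R ^ 2 - 1) := le_trans (by exact_mod_cast hm) hfl
      nlinarith [Real.sqrt_nonneg (R ^ 2 - 1)]
    refine le_trans ?_ (Finset.sum_le_sum_of_subset_of_nonneg
      (Finset.range_subset_range.mpr (Nat.succ_le_succ hm₀M)) fun m _ _ => by positivity)
    rw [Finset.sum_congr rfl hone]
    simp only [pow_zero, mul_one, Nat.factorial_zero, Nat.cast_one, Finset.sum_const,
      Finset.card_range, nsmul_eq_mul]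
    push_cast
    rw [div_le_iff₀ (by positivity)]
    have h2 : R ^ 2 ≤ 2 * ((m₀ : ℝ) + 1) ^ 2 := by
      have h3 : (0 : ℝ) ≤ m₀ := by positivity
      nlinarith [Real.sqrt_nonneg (R ^ 2 - 1)]
    have h3 := Real.sqrt_le_sqrt h2
    rw [Real.sqrt_sq (by linarith), Real.sqrt_mul (by norm_num),
      Real.sqrt_sq (by positivity)] at h3
    linarith
  | succ d ih =>
    refine le_trans ?_ (hrec (d + 1) R)
    have hterm : ∀ m ∈ Finset.range (M + 1), R / (√2 * (d.factorial : ℝ)) *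
        (if √(1 + (m : ℝ) ^ 2) ≤ R then
        Real.log (R / √(1 + (m : ℝ) ^ 2)) ^ d / √(1 + (m : ℝ) ^ 2) else 0) ≤
        ((hyperbolicCross v M (d + 1) (R / √(1 + (m : ℝ) ^ 2))).card : ℝ) := by
      intro m _
      have h1 : 1 ≤ √(1 + (m : ℝ) ^ 2) := one_le_sqrt_one_add_sq _
      split_ifs with h
      · refine le_trans (le_of_eq ?_) (ih ((one_le_div (by linarith)).mpr h)
          ((div_le_self (by linarith) h1).trans hM))
        field_simp
      · simp
    refine le_trans ?_ (Finset.sum_le_sum hterm)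
    rw [← Finset.mul_sum]
    refine le_trans (le_of_eq ?_) (mul_le_mul_of_nonneg_left (le_sum_log_pow_div hR d hM)
      (by positivity))
    rw [Nat.factorial_succ]
    push_cast
    field_simp

/-- A real-valued function with finite sublevel sets admits an injective ranking. -/
theorem exists_injective_rank {α : Type*} [Countable α] {W : α → ℝ}
    (hW : ∀ R, {k | W k ≤ R}.Finite) :
    ∃ r : α → ℕ, Function.Injective r ∧ ∀ k, r k + 1 ≤ {l | W l ≤ W k}.ncard := by
  obtain ⟨e, he⟩ := exists_injective_nat α
  set g : α → ℝ ×ₗ ℕ := fun k => toLex (W k, e k) with hg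
  have hginj : Function.Injective g := fun a b h => he (Prod.ext_iff.mp (toLex.injective h)).2
  have hle : ∀ {k l}, g l < g k → W l ≤ W k := fun h => (Prod.Lex.monotone_fst _ _ h.le)
  have hfin : ∀ k, {l | g l < g k}.Finite := fun k => (hW (W k)).subset fun l hl => hle hl
  have hmono : ∀ {k l}, g l < g k → {m | g m < g l}.ncard < {m | g m < g k}.ncard := by
    intro k l h
    refine Set.ncard_lt_ncard ⟨fun m hm => lt_trans hm h, fun hs => ?_⟩ (hfin k)
    exact lt_irrefl (g l) (hs (show l ∈ {m | g m < g k} from h))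
  refine ⟨fun k => {l | g l < g k}.ncard, fun k l h => ?_, fun k => ?_⟩
  · by_contra hne
    rcases lt_or_gt_of_ne (fun h' => hne (hginj h')) with h' | h'
    · exact (hmono h').ne h
    · exact (hmono h').ne' h
  · refine Nat.succ_le_of_lt (Set.ncard_lt_ncard ⟨fun l hl => hle hl, fun hs => ?_⟩ (hW _))
    exact lt_irrefl (g k) (hs (show k ∈ {l | W l ≤ W k} from le_refl (W k)))

theorem setOf_prod_le_eq_coe_hyperbolicCross {d : ℕ} (R : ℝ) :
    {k : ZLat d | ∏ j, (1 + |(k j : ℝ)|) ≤ R} =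
      ↑(hyperbolicCross (fun a => 1 + |(a : ℝ)|) ⌈R⌉₊ d R) := by
  ext k
  simp only [hyperbolicCross, Finset.coe_filter, Fintype.mem_piFinset, Set.mem_ofPred_eq,
    Finset.mem_Icc, ← abs_le]
  refine ⟨fun h => ⟨fun j => ?_, h⟩, fun h => h.2⟩
  have h1 : 1 + |(k j : ℝ)| ≤ ∏ j, (1 + |(k j : ℝ)|) := by
    rw [← Finset.mul_prod_erase _ _ (Finset.mem_univ j)]
    exact le_mul_of_one_le_right (by positivity) (Finset.one_le_prod fun i _ => by simp)
  have h2 : |(k j : ℝ)| ≤ (⌈R⌉₊ : ℝ) := by linarith [Nat.le_ceil R]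
  exact_mod_cast h2

theorem sum_choose_mul_log_pow_div_le {D : ℕ} {x L : ℝ} (hx : 0 ≤ x) (hxL : x ≤ L)
    (hL : (D : ℝ) ≤ L) :
    ∑ i ∈ Finset.range (D + 1), (D.choose i : ℝ) * 2 ^ i * (x ^ i / (i.factorial : ℝ)) ≤
      3 ^ D * (L ^ D / (D.factorial : ℝ)) := by
  have h3 : (3 : ℝ) ^ D = ∑ i ∈ Finset.range (D + 1), (D.choose i : ℝ) * 2 ^ i := by
    rw [show (3 : ℝ) = 2 + 1 by norm_num, add_pow]
    exact Finset.sum_congr rfl fun i _ => by rw [one_pow]; ring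
  rw [h3, Finset.sum_mul]
  refine Finset.sum_le_sum fun i hi => mul_le_mul_of_nonneg_left ?_ (by positivity)
  have hiD : i ≤ D := Nat.lt_succ_iff.mp (Finset.mem_range.mp hi)
  have h0 : 0 ≤ L := hx.trans hxL
  refine (div_le_div_of_nonneg_right (pow_le_pow_left₀ hx hxL i) (by positivity)).trans ?_
  rw [div_le_div_iff₀ (by positivity) (by positivity)]
  obtain ⟨e, rfl⟩ := Nat.exists_eq_add_of_le hiD
  have hf : ((i + e).factorial : ℝ) ≤ i.factorial * L ^ e := by
    have : (i + e).factorial ≤ i.factorial * (i + e) ^ e := by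
      rw [← Nat.factorial_mul_ascFactorial]
      exact Nat.mul_le_mul_left _ (Nat.ascFactorial_le_pow_add i e)
    calc ((i + e).factorial : ℝ) ≤ i.factorial * ((i + e : ℕ) : ℝ) ^ e := by exact_mod_cast this
      _ ≤ _ := by gcongr
  calc L ^ i * ((i + e).factorial : ℝ) ≤ L ^ i * (i.factorial * L ^ e) := by gcongr
    _ = _ := by ring

theorem rpow_neg_le_sub_div {p : ℝ} (hp : 0 < p) {j : ℕ} (hj : 2 ≤ j) :
    (j : ℝ) ^ (-(p + 1)) ≤ (((j - 1 : ℕ) : ℝ) ^ (-p) - (j : ℝ) ^ (-p)) / p := by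
  obtain ⟨m, rfl⟩ := Nat.exists_eq_add_of_le' hj
  rw [show m + 2 - 1 = m + 1 from rfl]
  push_cast
  have hm : (0 : ℝ) < m + 1 := by positivity
  have hm2 : (0 : ℝ) < m + 2 := by positivity
  have h1 : (m + 1 : ℝ) ^ (-p) = (m + 2 : ℝ) ^ (-p) * ((m + 1) / (m + 2) : ℝ) ^ (-p) := by
    rw [← Real.mul_rpow hm2.le (by positivity)]
    congr 1
    field_simp
  have h2 : 1 + p / (m + 2) ≤ ((m + 1) / (m + 2) : ℝ) ^ (-p) := by
    rw [Real.rpow_def_of_pos (by positivity)]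
    have h3 := Real.log_le_sub_one_of_pos (x := ((m + 1) / (m + 2) : ℝ)) (by positivity)
    have h4 : ((m + 1) / (m + 2) : ℝ) - 1 = -(1 / (m + 2)) := by field_simp; ring
    rw [h4] at h3
    have h5 := Real.add_one_le_exp (Real.log ((m + 1) / (m + 2) : ℝ) * -p)
    have h6 : p / (m + 2) = p * (1 / (m + 2)) := by ring
    rw [h6]
    nlinarith
  rw [le_div_iff₀ hp, h1]
  have h7 : (m + 2 : ℝ) ^ (-(p + 1)) * p = (m + 2 : ℝ) ^ (-p) * (p / (m + 2)) := by
    rw [neg_add, Real.rpow_add hm2, Real.rpow_neg_one]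
    ring
  rw [h7]
  have h8 : (0 : ℝ) ≤ (m + 2 : ℝ) ^ (-p) := by positivity
  nlinarith

theorem sum_rpow_neg_le {p : ℝ} (hp : 0 < p) {n : ℕ} (hn : 2 ≤ n) {F : Finset ℕ}
    (hF : ∀ j ∈ F, n ≤ j) :
    ∑ j ∈ F, (j : ℝ) ^ (-(p + 1)) ≤ ((n : ℝ) - 1) ^ (-p) / p := by
  obtain ⟨N, hN⟩ := F.bddAbove
  have hsub : F ⊆ (Finset.range (N + 1)).image fun m => n + m := by
    intro j hj
    have h1 := hF j hj
    have h2 := hN hj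
    exact Finset.mem_image.mpr ⟨j - n, Finset.mem_range.mpr (by omega), by omega⟩
  refine (Finset.sum_le_sum_of_subset_of_nonneg hsub fun j _ _ => by positivity).trans ?_
  rw [Finset.sum_image fun a _ b _ h => by simpa using h]
  refine (Finset.sum_le_sum fun m _ => rpow_neg_le_sub_div hp (by omega : 2 ≤ n + m)).trans ?_
  rw [← Finset.sum_div]
  have h := Finset.sum_range_sub' (fun m => (((n - 1 + m : ℕ)) : ℝ) ^ (-p)) (N + 1)
  have h2 : ∀ m, ((n + m - 1 : ℕ) : ℝ) = ((n - 1 + m : ℕ) : ℝ) := fun m => by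
    congr 1
    omega
  have h3 : ∀ m, ((n + m : ℕ) : ℝ) = ((n - 1 + (m + 1) : ℕ) : ℝ) := fun m => by
    congr 1
    omega
  simp only [h2, h3]
  rw [h]
  have h4 : (0 : ℝ) ≤ (((n - 1 + (N + 1) : ℕ)) : ℝ) ^ (-p) := by positivity
  have h5 : (((n - 1 + 0 : ℕ)) : ℝ) = (n : ℝ) - 1 := by
    rw [add_zero, Nat.cast_sub (by omega), Nat.cast_one]
  rw [h5]
  gcongr
  linarith

theorem natCast_le_of_le_card_hyperbolicCross {D M j : ℕ} {R : ℝ} (hR : 1 ≤ R)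
    (hL : (D : ℝ) + 1 ≤ Real.log j)
    (hj : j ≤ (hyperbolicCross (fun a => 1 + |(a : ℝ)|) M (D + 1) R).card) :
    (j : ℝ) ≤ 2 * R * (3 ^ D * (Real.log j ^ D / (D.factorial : ℝ))) := by
  have hj0 : (0 : ℝ) < j := by
    rcases Nat.eq_zero_or_pos j with rfl | h
    · have : (0 : ℝ) ≤ D := by positivity
      simp at hL
      linarith
    · exact_mod_cast h
  rcases le_or_gt R j with h | h
  · have h1 : (j : ℝ) ≤ _ := (Nat.cast_le.mpr hj).trans (card_hyperbolicCross_le D M hR)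
    refine h1.trans (mul_le_mul_of_nonneg_left ?_ (by linarith))
    exact sum_choose_mul_log_pow_div_le (Real.log_nonneg hR)
      (Real.log_le_log (by linarith) h) (by linarith)
  · have h1 : 1 ≤ Real.log j ^ D / (D.factorial : ℝ) := by
      rw [one_le_div (by positivity)]
      calc (D.factorial : ℝ) ≤ (D : ℝ) ^ D := by exact_mod_cast D.factorial_le_pow
        _ ≤ _ := by
          gcongr
          linarith
    have h2 : (1 : ℝ) ≤ 3 ^ D := one_le_pow₀ (by norm_num)
    have h3 : 1 ≤ 3 ^ D * (Real.log j ^ D / (D.factorial : ℝ)) := one_le_mul_of_one_le_of_one_le h2 h1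
    nlinarith

theorem log_rpow_le_log_rpow_mul {α p x y : ℝ} (hα : 0 ≤ α) (hx : 1 < x) (hxy : x ≤ y)
    (h : α ≤ p * Real.log x) :
    Real.log y ^ α ≤ Real.log x ^ α * (y / x) ^ p := by
  have hlx : 0 < Real.log x := Real.log_pos hx
  have hly : Real.log x ≤ Real.log y := Real.log_le_log (by linarith) hxy
  set t := (Real.log y - Real.log x) / Real.log x with ht
  have ht0 : 0 ≤ t := div_nonneg (by linarith) hlx.le
  have h1 : Real.log y = Real.log x * (t + 1) := by
    rw [ht]
    field_simp
    ring
  rw [h1, Real.mul_rpow hlx.le (by linarith)]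
  refine mul_le_mul_of_nonneg_left ?_ (by positivity)
  refine (Real.rpow_le_rpow (by linarith) (Real.add_one_le_exp t) hα).trans ?_
  rw [← Real.exp_mul, Real.rpow_def_of_pos (div_pos (by linarith) (by linarith)),
    Real.log_div (by linarith) (by linarith)]
  refine Real.exp_le_exp.mpr ?_
  calc t * α ≤ t * (p * Real.log x) := by gcongr
    _ = _ := by rw [ht]; field_simp

theorem wMix_two_eq_rpow (d : ℕ) (s : ℝ) (k : ZLat d) :
    wMix d s 2 k = (∏ j, √(1 + (k j : ℝ) ^ 2)) ^ s := by
  rw [wMix, ← Real.finsetProd_rpow _ _ fun j _ => Real.sqrt_nonneg _]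
  refine Finset.prod_congr rfl fun j _ => ?_
  rw [Real.sqrt_eq_rpow, ← Real.rpow_mul (by positivity), Real.rpow_two, sq_abs]
  congr 1
  ring

theorem prod_sqrt_one_add_sq_pos {d : ℕ} (k : ZLat d) : 0 < ∏ j, √(1 + (k j : ℝ) ^ 2) :=
  Finset.prod_pos fun _ _ => zero_lt_one.trans_le (one_le_sqrt_one_add_sq _)

theorem inv_wMix_two_sq {d : ℕ} (s : ℝ) (k : ZLat d) :
    (wMix d s 2 k)⁻¹ ^ 2 = (∏ j, √(1 + (k j : ℝ) ^ 2))⁻¹ ^ (2 * s) := by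
  have h := (prod_sqrt_one_add_sq_pos k).le
  rw [wMix_two_eq_rpow, ← Real.inv_rpow h, ← Real.rpow_mul_natCast (inv_nonneg.mpr h)]
  congr 1
  push_cast
  ring

theorem prod_one_add_abs_le {d : ℕ} (k : ZLat d) :
    ∏ j, (1 + |(k j : ℝ)|) ≤ √2 ^ d * ∏ j, √(1 + (k j : ℝ) ^ 2) := by
  have h : √2 ^ d = ∏ _j : Fin d, √2 := by simp
  rw [h, ← Finset.prod_mul_distrib]
  refine Finset.prod_le_prod (fun j _ => by positivity) fun j _ => ?_
  rw [← Real.sqrt_mul (by norm_num)]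
  refine Real.le_sqrt_of_sq_le ?_
  nlinarith [sq_nonneg (1 - |(k j : ℝ)|), sq_abs (k j : ℝ)]

/-- The upper bound for the approximation numbers of the mixed-smoothness embedding. -/
theorem approxNum_mixed_le {D : ℕ} {s : ℝ} (hs : 1 / 2 < s)
    (T : ellTwo (D + 1) →L[ℂ] Lp ℂ ⊤ (torusMeasure (D + 1)))
    (hT : ∀ (c : ellTwo (D + 1)) (k : ZLat (D + 1)),
      fourierCoef (⇑(T c)) k = c k / (wMix (D + 1) s 2 k : ℂ))
    {n : ℕ} (hn : (27 : ℝ) ^ (D + 1) < n) (hn' : Real.exp (4 * D * s / (2 * s - 1)) < n) :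
    approxNum T n ≤ √(2 / (2 * s - 1)) * ((3 * √2) ^ (D + 1) / (D.factorial : ℝ)) ^ s *
      Real.log n ^ (D * s) / (n : ℝ) ^ (s - 1 / 2) := by
  have hn27 : (27 : ℝ) < n := lt_of_le_of_lt (by
    simpa using pow_le_pow_right₀ (by norm_num : (1 : ℝ) ≤ 27) (Nat.le_add_left 1 D)) hn
  have hn2 : 2 ≤ n := by
    have : (2 : ℝ) ≤ n := by linarith
    exact_mod_cast this
  have hn0 : (0 : ℝ) < n := by linarith
  set p := s - 1 / 2 with hp
  have hp0 : 0 < p := by linarith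
  set C := (3 * √2) ^ (D + 1) / (D.factorial : ℝ) with hC
  have hC0 : 0 < C := by positivity
  set L := Real.log n with hLdef
  have hLD : (D : ℝ) + 1 ≤ L := by
    have h1 : (D : ℝ) + 1 ≤ Real.log (27 ^ (D + 1)) := by
      rw [Real.log_pow]
      have h2 : 1 ≤ Real.log 27 := by
        rw [Real.le_log_iff_exp_le (by norm_num)]
        linarith [Real.exp_one_lt_d9]
      push_cast
      nlinarith
    exact h1.trans (Real.log_le_log (by positivity) hn.le)
  have hL0 : 0 < L := by
    have : (0 : ℝ) ≤ D := by positivity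
    linarith
  have hα : D * (2 * s) ≤ p * L := by
    have h1 := (Real.lt_log_iff_exp_lt hn0).mpr hn'
    rw [div_lt_iff₀ (by linarith)] at h1
    rw [hp]
    linarith
  have hb0 : 0 ≤ √(2 / (2 * s - 1)) * C ^ s * L ^ (D * s) / (n : ℝ) ^ p := by positivity
  have hbsq : (√(2 / (2 * s - 1)) * C ^ s * L ^ (D * s) / (n : ℝ) ^ p) ^ 2 =
      C ^ (2 * s) * L ^ (D * (2 * s)) * (n : ℝ) ^ (-p) * ((n : ℝ) ^ (-p) / p) := by
    have e : ∀ {x y : ℝ}, 0 ≤ x → (x ^ y) ^ 2 = x ^ (2 * y) := fun hx => by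
      rw [← Real.rpow_mul_natCast hx]
      congr 1
      push_cast
      ring
    rw [div_pow, mul_pow, mul_pow, Real.sq_sqrt (div_nonneg (by norm_num) (by linarith)),
      e hC0.le, e hL0.le, Real.rpow_neg hn0.le, hp,
      show (D : ℝ) * (2 * s) = 2 * (D * s) by ring]
    have : 2 * s - 1 ≠ 0 := by linarith
    have : s - 1 / 2 ≠ 0 := by linarith
    have : (n : ℝ) ^ (s - 1 / 2) ≠ 0 := by positivity
    field_simp
  have hfin : ∀ R : ℝ, {k : ZLat (D + 1) | ∏ j, (1 + |(k j : ℝ)|) ≤ R}.Finite := fun R => by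
    rw [setOf_prod_le_eq_coe_hyperbolicCross]
    exact Finset.finite_toSet _
  obtain ⟨r, hrinj, hr⟩ := exists_injective_rank hfin
  have hSfin : {k | r k < n - 1}.Finite :=
    Set.Finite.preimage hrinj.injOn (Set.finite_Iio (n - 1))
  have hterm : ∀ k, n ≤ r k + 1 → (wMix (D + 1) s 2 k)⁻¹ ^ 2 ≤
      (2 / 3) ^ (2 * s) * C ^ (2 * s) * L ^ (D * (2 * s)) * (n : ℝ) ^ (-p) *
        ((r k + 1 : ℕ) : ℝ) ^ (-(p + 1)) := by
    intro k hk
    set j := r k + 1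
    set W := ∏ i, (1 + |(k i : ℝ)|) with hW
    set V := ∏ i, √(1 + (k i : ℝ) ^ 2) with hV
    have hV0 : 0 < V := prod_sqrt_one_add_sq_pos k
    have hW1 : 1 ≤ W := Finset.one_le_prod fun i _ => by simp
    have hnj : (n : ℝ) ≤ j := by exact_mod_cast hk
    have hj0 : (0 : ℝ) < j := by linarith
    have hLj : L ≤ Real.log j := Real.log_le_log hn0 hnj
    have hcard := hr k
    rw [setOf_prod_le_eq_coe_hyperbolicCross, Set.ncard_coe_finset] at hcard
    have h1 := natCast_le_of_le_card_hyperbolicCross hW1 (hLD.trans hLj) hcard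
    have h2 : V⁻¹ ≤ 2 / 3 * C * Real.log j ^ D / j := by
      rw [inv_le_iff_one_le_mul₀ hV0, ← mul_div_right_comm, one_le_div hj0]
      refine h1.trans ?_
      have h3 := mul_le_mul_of_nonneg_left (prod_one_add_abs_le k)
        (by positivity : 0 ≤ 2 * (3 ^ D * (Real.log j ^ D / (D.factorial : ℝ))))
      refine le_trans (le_of_eq ?_) (h3.trans (le_of_eq ?_))
      · rw [hW]
        ring
      · rw [hC, hV, mul_pow]
        ring
    have hLj0 : 0 < Real.log j := hL0.trans_le hLj
    rw [inv_wMix_two_sq]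
    refine (Real.rpow_le_rpow (inv_nonneg.mpr hV0.le) h2 (by linarith)).trans ?_
    rw [Real.div_rpow (by positivity) hj0.le, Real.mul_rpow (by positivity) (by positivity),
      Real.mul_rpow (by positivity) hC0.le, ← Real.rpow_natCast (Real.log j),
      ← Real.rpow_mul hLj0.le]
    have h4 := log_rpow_le_log_rpow_mul (by positivity : 0 ≤ D * (2 * s)) (by linarith) hnj hα
    rw [Real.div_rpow hj0.le hn0.le] at h4
    rw [div_eq_mul_inv, ← Real.rpow_neg hj0.le]
    have h5 : (j : ℝ) ^ (-(p + 1)) = (j : ℝ) ^ p * (j : ℝ) ^ (-(2 * s)) := by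
      rw [← Real.rpow_add hj0]
      congr 1
      rw [hp]
      ring
    rw [h5, Real.rpow_neg hn0.le]
    calc _ ≤ (2 / 3) ^ (2 * s) * C ^ (2 * s) * (L ^ (D * (2 * s)) * ((j : ℝ) ^ p / (n : ℝ) ^ p)) *
          (j : ℝ) ^ (-(2 * s)) := by gcongr
      _ = _ := by ring
  refine approxNum_le_of_sum_le hT (S := hSfin.toFinset) ?_ hb0 fun F hF => ?_
  · have h1 : hSfin.toFinset.card ≤ (Finset.range (n - 1)).card :=
      Finset.card_le_card_of_injOn r (fun k hk => by simpa using hk) hrinj.injOn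
    rw [Finset.card_range] at h1
    omega
  · have hFn : ∀ k ∈ F, n ≤ r k + 1 := by
      intro k hk
      have := Finset.disjoint_left.mp hF hk
      simp only [Set.Finite.mem_toFinset, Set.mem_ofPred_eq, not_lt] at this
      omega
    refine (Finset.sum_le_sum fun k hk => hterm k (hFn k hk)).trans ?_
    rw [← Finset.mul_sum, hbsq]
    have hsum : ∑ k ∈ F, ((r k + 1 : ℕ) : ℝ) ^ (-(p + 1)) ≤ ((n : ℝ) - 1) ^ (-p) / p := by
      rw [← Finset.sum_image (s := F) (g := fun k => r k + 1)
        (f := fun j : ℕ => (j : ℝ) ^ (-(p + 1))) (fun a _ b _ h => hrinj (by simpa using h))]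
      refine sum_rpow_neg_le hp0 hn2 fun j hj => ?_
      obtain ⟨k, hk, rfl⟩ := Finset.mem_image.mp hj
      exact hFn k hk
    have hconst : (2 / 3 : ℝ) ^ (2 * s) * ((n : ℝ) - 1) ^ (-p) ≤ (n : ℝ) ^ (-p) := by
      have h1 : (2 / 3 : ℝ) ^ (2 * s) ≤ (9 / 4 : ℝ) ^ (-p) := by
        rw [Real.rpow_mul (by norm_num), Real.rpow_neg (by norm_num),
          ← Real.inv_rpow (by norm_num), Real.rpow_two,
          show (2 / 3 : ℝ) ^ 2 = (9 / 4)⁻¹ by norm_num]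
        exact Real.rpow_le_rpow_of_exponent_ge (by norm_num) (by norm_num) (by linarith)
      have h2 : (0 : ℝ) ≤ ((n : ℝ) - 1) ^ (-p) := Real.rpow_nonneg (by linarith) _
      refine (mul_le_mul_of_nonneg_right h1 h2).trans ?_
      rw [← Real.mul_rpow (by norm_num) (by linarith)]
      exact Real.rpow_le_rpow_of_nonpos hn0 (by linarith) (by linarith)
    have h6 : 0 ≤ C ^ (2 * s) * L ^ (D * (2 * s)) * (n : ℝ) ^ (-p) := by positivity
    calc _ ≤ (2 / 3) ^ (2 * s) * C ^ (2 * s) * L ^ (D * (2 * s)) * (n : ℝ) ^ (-p) *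
          (((n : ℝ) - 1) ^ (-p) / p) := by gcongr
      _ = C ^ (2 * s) * L ^ (D * (2 * s)) * (n : ℝ) ^ (-p) *
          ((2 / 3) ^ (2 * s) * ((n : ℝ) - 1) ^ (-p) / p) := by ring
      _ ≤ _ := by gcongr

theorem exists_injective_of_lt_card {α : Type*} {t : ℕ → Finset α} (ht : ∀ i, i < (t i).card) :
    ∃ f : ℕ → α, Function.Injective f ∧ ∀ i, f i ∈ t i := by
  classical
  refine (Finset.all_card_le_biUnion_card_iff_exists_injective t).mp fun S => ?_
  rcases S.eq_empty_or_nonempty with rfl | hS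
  · simp
  · have h1 : S ⊆ Finset.range (S.max' hS + 1) := fun i hi =>
      Finset.mem_range.mpr (Nat.lt_succ_of_le (S.le_max' i hi))
    have h2 := Finset.card_le_card h1
    rw [Finset.card_range] at h2
    exact h2.trans ((Nat.succ_le_of_lt (ht _)).trans
      (Finset.card_le_card (Finset.subset_biUnion_of_mem t (S.max'_mem hS))))

theorem half_log_le_log_factorial {d : ℕ} {L : ℝ} (hd : 0 < d) (hL : 1 ≤ L) :
    L / 2 ≤ L + Real.log (d.factorial * 2 ^ d) - (d - 1 : ℕ) * Real.log L := by
  have hd0 : (0 : ℝ) < d := by exact_mod_cast hd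
  have h1 : Real.log L ≤ Real.log 2 + Real.log d + (L / (2 * d) - 1) := by
    have h := Real.log_le_sub_one_of_pos (x := L / (2 * d)) (by positivity)
    rw [Real.log_div (by positivity) (by positivity),
      Real.log_mul (by norm_num) (by positivity)] at h
    linarith
  have h2 : ((d - 1 : ℕ) : ℝ) * Real.log L ≤ d * Real.log L := by
    gcongr
    · exact Real.log_nonneg hL
    · omega
  have h3 : d * Real.log L ≤ d * (Real.log 2 + Real.log d + (L / (2 * d) - 1)) := by gcongr
  have h4 : (d : ℝ) * (Real.log 2 + Real.log d + (L / (2 * d) - 1)) =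
      d * Real.log 2 + d * Real.log d + L / 2 - d := by
    field_simp
    ring
  have h5 : d * Real.log d - d ≤ Real.log d.factorial := by
    have h := Real.pow_div_factorial_le_exp (d : ℝ) hd0.le d
    have h' := Real.log_le_log (by positivity) h
    rw [Real.log_exp, Real.log_div (by positivity) (by positivity), Real.log_pow] at h'
    linarith
  rw [Real.log_mul (by positivity) (by positivity), Real.log_pow]
  linarith

theorem exists_injective_prod_sqrt_le {D n : ℕ} (hn : 0 < n) {L : ℝ} (hL : L = Real.log n)
    (hL1 : 1 ≤ L) :
    ∃ f : ℕ → ZLat (D + 1), Function.Injective f ∧ ∀ i, ∏ j, √(1 + (f i j : ℝ) ^ 2) ≤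
      (max (i + 1) n : ℕ) * ((D + 1).factorial * 2 ^ (D + 1) / L ^ D) := by
  set K := (D + 1).factorial * 2 ^ (D + 1) / L ^ D with hK
  have hK0 : 0 < K := by positivity
  have hn0 : (0 : ℝ) < n := by exact_mod_cast hn
  have hlog : L / 2 ≤ Real.log (n * K) := by
    have h := half_log_le_log_factorial D.succ_pos hL1
    rw [Real.log_mul (by positivity) (by positivity), hK,
      Real.log_div (by positivity) (by positivity), Real.log_pow, ← hL]
    simp only [Nat.succ_eq_add_one, Nat.add_sub_cancel] at h
    linarith
  have hcard : ∀ j : ℕ, n ≤ j → j ≤ (hyperbolicCross (fun a => √(1 + (a : ℝ) ^ 2))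
      ⌈(j : ℝ) * K⌉₊ (D + 1) (j * K)).card := by
    intro j hj
    have hnj : (n : ℝ) ≤ j := by exact_mod_cast hj
    have hlogj : L / 2 ≤ Real.log (j * K) :=
      hlog.trans (Real.log_le_log (by positivity) (by gcongr))
    have hR : 1 ≤ (j : ℝ) * K := by
      by_contra! h
      have := Real.log_nonpos (by positivity) h.le
      linarith
    have h := le_card_hyperbolicCross D hR (Nat.le_ceil _)
    have h2 : (j : ℝ) ≤ (j : ℝ) * K * Real.log (j * K) ^ D / (√2 * (D.factorial : ℝ)) := by
      rw [le_div_iff₀ (by positivity)]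
      have h3 : (L / 2) ^ D ≤ Real.log (j * K) ^ D := by gcongr
      refine le_trans ?_ (mul_le_mul_of_nonneg_left h3 (by positivity))
      have h4 : (j : ℝ) * K * (L / 2) ^ D = j * (2 * (D + 1) * D.factorial) := by
        rw [hK, Nat.factorial_succ, div_pow, pow_succ]
        push_cast
        field_simp
      rw [h4]
      have h5 : √2 ≤ 2 * (D + 1) := by
        have h6 : √2 ≤ 2 := Real.sqrt_le_left (by norm_num) |>.mpr (by norm_num)
        have h7 : (0 : ℝ) ≤ D := by positivity
        linarith
      gcongr
    exact_mod_cast h2.trans h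
  obtain ⟨f, hf, hmem⟩ := exists_injective_of_lt_card
    (t := fun i => hyperbolicCross (fun a => √(1 + (a : ℝ) ^ 2))
      ⌈((max (i + 1) n : ℕ) : ℝ) * K⌉₊ (D + 1) ((max (i + 1) n : ℕ) * K))
    fun i => (Nat.lt_of_succ_le (le_max_left (i + 1) n)).trans_le (hcard _ (le_max_right _ _))
  exact ⟨f, hf, fun i => (Finset.mem_filter.mp (hmem i)).2⟩

theorem sub_div_le_rpow_neg {q : ℝ} (hq : 0 < q) {j : ℕ} (hj : 0 < j) :
    ((j : ℝ) ^ (-q) - ((j + 1 : ℕ) : ℝ) ^ (-q)) / q ≤ (j : ℝ) ^ (-(q + 1)) := by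
  have hj0 : (0 : ℝ) < j := by exact_mod_cast hj
  push_cast
  have h1 : (j + 1 : ℝ) ^ (-q) = (j : ℝ) ^ (-q) * (1 + 1 / j : ℝ) ^ (-q) := by
    rw [← Real.mul_rpow hj0.le (by positivity)]
    congr 1
    field_simp
  have h2 : 1 - q / j ≤ (1 + 1 / j : ℝ) ^ (-q) := by
    rw [Real.rpow_def_of_pos (by positivity)]
    have h3 := Real.log_le_sub_one_of_pos (x := (1 + 1 / j : ℝ)) (by positivity)
    have h5 := Real.add_one_le_exp (Real.log (1 + 1 / j : ℝ) * -q)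
    have h6 : q / j = q * (1 / j) := by ring
    rw [h6]
    nlinarith
  rw [div_le_iff₀ hq, h1]
  have h7 : (j : ℝ) ^ (-(q + 1)) * q = (j : ℝ) ^ (-q) * (q / j) := by
    rw [neg_add, Real.rpow_add hj0, Real.rpow_neg_one]
    ring
  rw [h7]
  have h8 : (0 : ℝ) ≤ (j : ℝ) ^ (-q) := by positivity
  nlinarith

theorem rpow_neg_div_le_of_forall_sum_le {q b : ℝ} (hq : 0 < q) {n : ℕ} (hn : 0 < n)
    (h : ∀ m, ∑ i ∈ Finset.range m, ((n + i : ℕ) : ℝ) ^ (-(q + 1)) ≤ b) :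
    (n : ℝ) ^ (-q) / q ≤ b := by
  have h1 : ∀ m : ℕ, ((n : ℝ) ^ (-q) - ((n + m : ℕ) : ℝ) ^ (-q)) / q ≤ b := by
    intro m
    refine le_trans ?_ (h m)
    have h2 := Finset.sum_range_sub' (fun i => ((n + i : ℕ) : ℝ) ^ (-q)) m
    rw [add_zero] at h2
    rw [← h2, Finset.sum_div]
    exact Finset.sum_le_sum fun i _ => sub_div_le_rpow_neg hq (by omega)
  have h2 : Tendsto (fun m : ℕ => ((n + m : ℕ) : ℝ) ^ (-q)) atTop (nhds 0) :=
    (tendsto_rpow_neg_atTop hq).comp (tendsto_natCast_atTop_atTop.comp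
      (tendsto_atTop_mono (fun m => Nat.le_add_left m n) tendsto_id))
  have h3 := (h2.const_sub ((n : ℝ) ^ (-q))).div_const q
  rw [sub_zero] at h3
  exact le_of_tendsto' h3 h1

theorem log_two_mul_pow_le {D : ℕ} {x : ℝ} (hx : 1 < x) (h : 4 * (D : ℝ) ≤ Real.log x) :
    Real.log (2 * x) ^ D ≤ 6 / 5 * Real.log x ^ D := by
  have hL := Real.log_pos hx
  have hl2 : 0 < Real.log 2 := Real.log_pos (by norm_num)
  have h1 : Real.log (2 * x) = (Real.log 2 / Real.log x + 1) * Real.log x := by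
    rw [Real.log_mul (by norm_num) (by linarith)]
    field_simp
  rw [h1, mul_pow]
  refine mul_le_mul_of_nonneg_right ?_ (by positivity)
  refine (pow_le_pow_left₀ (by positivity) (Real.add_one_le_exp _) D).trans ?_
  rw [← Real.exp_nat_mul, ← Real.le_log_iff_exp_le (by norm_num)]
  have h2 : Real.log 2 ≤ 4 * Real.log (6 / 5) := by
    rw [show (4 : ℝ) = (4 : ℕ) by norm_num, ← Real.log_pow]
    exact Real.log_le_log (by norm_num) (by norm_num)
  have h3 : D * (Real.log 2 / Real.log x) ≤ Real.log 2 / 4 := by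
    rw [← mul_div_assoc, div_le_div_iff₀ hL (by norm_num)]
    nlinarith
  linarith

theorem rpow_div_le_norm_sub_sq {d n : ℕ} {s K : ℝ} (hs : 1 / 2 < s) (hK : 0 < K) (hn : 0 < n)
    {T A : ellTwo d →L[ℂ] Lp ℂ ⊤ (torusMeasure d)}
    (hT : ∀ (c : ellTwo d) (k : ZLat d), fourierCoef (⇑(T c)) k = c k / (wMix d s 2 k : ℂ))
    (hA : Module.rank ℂ (LinearMap.range (A : ellTwo d →ₗ[ℂ] Lp ℂ ⊤ (torusMeasure d))) < n)
    {f : ℕ → ZLat d} (hf : Function.Injective f)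
    (hfK : ∀ i, ∏ j, √(1 + (f i j : ℝ) ^ 2) ≤ (max (i + 1) n : ℕ) * K) :
    K⁻¹ ^ (2 * s) * ((n : ℝ) ^ (-(2 * s - 1)) / (2 * s - 1)) ≤ ‖T - A‖ ^ 2 := by
  set u : ℕ → ℝ := fun i => (((max (i + 1) n : ℕ) : ℝ) * K)⁻¹ ^ (2 * s) with hu
  have hn0 : (0 : ℝ) < n := by exact_mod_cast hn
  have hmax : ∀ i, (0 : ℝ) < (max (i + 1) n : ℕ) := fun i => by
    exact_mod_cast (Nat.succ_pos i).trans_le (le_max_left _ _)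
  have huw : ∀ i, u i ≤ (wMix d s 2 (f i))⁻¹ ^ 2 := by
    intro i
    rw [inv_wMix_two_sq]
    refine Real.rpow_le_rpow (inv_nonneg.mpr (mul_pos (hmax i) hK).le) ?_ (by linarith)
    exact inv_anti₀ (prod_sqrt_one_add_sq_pos _) (hfK i)
  have hu0 : ∀ i, u i ≤ (n * K)⁻¹ ^ (2 * s) := by
    intro i
    refine Real.rpow_le_rpow (inv_nonneg.mpr (mul_pos (hmax i) hK).le) ?_ (by linarith)
    refine inv_anti₀ (by positivity) (mul_le_mul_of_nonneg_right ?_ hK.le)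
    exact_mod_cast le_max_right _ _
  have hsum : ∀ m, ∑ i ∈ Finset.range m, (((n + i : ℕ) : ℝ) * K)⁻¹ ^ (2 * s) ≤ ‖T - A‖ ^ 2 := by
    intro m
    obtain ⟨q, hq0, hq1, hqn, hq⟩ :=
      exists_sum_le_norm_sub_sq hT hA ((Finset.range (n - 1 + m)).image f)
    rw [Finset.sum_image hf.injOn] at hqn hq
    have h1 : ∑ i ∈ Finset.range (n - 1 + m), (u i - (n * K)⁻¹ ^ (2 * s) * q (f i)) ≤
        ‖T - A‖ ^ 2 := by
      refine le_trans (Finset.sum_le_sum fun i _ => ?_) hq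
      have h2 := mul_le_mul_of_nonneg_right (huw i) (sub_nonneg.mpr (hq1 (f i)))
      have h3 := mul_le_mul_of_nonneg_right (hu0 i) (hq0 (f i))
      linarith
    rw [Finset.sum_sub_distrib, ← Finset.mul_sum, Finset.sum_range_add] at h1
    have h4 : ∑ i ∈ Finset.range (n - 1), u i = ((n : ℝ) - 1) * (n * K)⁻¹ ^ (2 * s) := by
      rw [Finset.sum_congr rfl (g := fun _ => (n * K)⁻¹ ^ (2 * s)), Finset.sum_const,
        Finset.card_range, nsmul_eq_mul, Nat.cast_sub hn, Nat.cast_one]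
      intro i hi
      rw [Finset.mem_range] at hi
      simp only [hu]
      rw [max_eq_right (by omega)]
    have h5 : ∀ i, u (n - 1 + i) = (((n + i : ℕ) : ℝ) * K)⁻¹ ^ (2 * s) := by
      intro i
      simp only [hu]
      rw [max_eq_left (by omega), show n - 1 + i + 1 = n + i by omega]
    simp only [h4, h5] at h1
    have h6 := mul_le_mul_of_nonneg_left hqn
      (by positivity : 0 ≤ ((n : ℝ) * K)⁻¹ ^ (2 * s))
    linarith
  have hq : 0 < 2 * s - 1 := by linarith
  have hKs : 0 < K⁻¹ ^ (2 * s) := by positivity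
  rw [← le_div_iff₀' hKs]
  refine rpow_neg_div_le_of_forall_sum_le hq hn fun m => ?_
  rw [le_div_iff₀' hKs]
  refine le_trans (le_of_eq ?_) (hsum m)
  rw [Finset.mul_sum]
  refine Finset.sum_congr rfl fun i _ => ?_
  rw [mul_inv, Real.mul_rpow (by positivity) (by positivity), mul_comm, sub_add_cancel,
    Real.rpow_neg (by positivity),
    Real.inv_rpow (by positivity : (0 : ℝ) ≤ ((n + i : ℕ) : ℝ))]

/-- The lower bound for the approximation numbers of the mixed-smoothness embedding. -/
theorem le_approxNum_mixed {D : ℕ} {s : ℝ} (hs : 1 / 2 < s)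
    (T : ellTwo (D + 1) →L[ℂ] Lp ℂ ⊤ (torusMeasure (D + 1)))
    (hT : ∀ (c : ellTwo (D + 1)) (k : ZLat (D + 1)),
      fourierCoef (⇑(T c)) k = c k / (wMix (D + 1) s 2 k : ℂ))
    {n : ℕ} (hn : ((12 : ℝ) * Real.exp 1 ^ 2) ^ (D + 1) < n) :
    √(1 / (4 * s - 2)) *
        (5 / (6 * ((D + 1).factorial : ℝ) * (1 + Real.log √12) ^ (D + 1))) ^ s *
        Real.log (2 * (n : ℝ)) ^ (D * s) / (n : ℝ) ^ (s - 1 / 2) ≤ approxNum T n := by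
  have hn0 : (0 : ℝ) < n := lt_trans (by positivity) hn
  have hnpos : 0 < n := by exact_mod_cast hn0
  have hlog12 : 2 ≤ Real.log 12 := by
    rw [Real.le_log_iff_exp_le (by norm_num), show (2 : ℝ) = (2 : ℕ) * 1 by norm_num,
      Real.exp_nat_mul]
    nlinarith [Real.exp_one_lt_d9, Real.exp_pos 1]
  set L := Real.log n with hL
  have hLD : 4 * ((D : ℝ) + 1) ≤ L := by
    have h := Real.log_le_log (by positivity) hn.le
    rw [Real.log_pow, Real.log_mul (by norm_num) (by positivity), Real.log_pow,
      Real.log_exp] at h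
    push_cast at h
    have : (0 : ℝ) ≤ D := by positivity
    nlinarith
  have hD0 : (0 : ℝ) ≤ D := by positivity
  have hL1 : 1 ≤ L := by linarith
  have hn1 : (1 : ℝ) < n := by
    by_contra! h
    have := Real.log_nonpos hn0.le h
    linarith
  set K : ℝ := (D + 1).factorial * 2 ^ (D + 1) / L ^ D with hK
  have hK0 : 0 < K := by positivity
  obtain ⟨f, hf, hfK⟩ := exists_injective_prod_sqrt_le (D := D) hnpos hL hL1
  set β := 1 + Real.log √12 with hβ
  have hβ2 : 2 ≤ β := by
    rw [hβ, Real.log_sqrt (by norm_num)]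
    linarith
  set B := 5 / (6 * ((D + 1).factorial : ℝ) * β ^ (D + 1)) with hB
  have hB0 : 0 < B := by positivity
  have hl0 : 0 < Real.log (2 * (n : ℝ)) := Real.log_pos (by linarith)
  have hBK : B * Real.log (2 * (n : ℝ)) ^ D ≤ K⁻¹ := by
    have h1 := log_two_mul_pow_le hn1 (by linarith : 4 * (D : ℝ) ≤ Real.log n)
    refine (mul_le_mul_of_nonneg_left h1 hB0.le).trans ?_
    rw [← hL, hB, hK, inv_div]
    have h2 : 5 / (6 * ((D + 1).factorial : ℝ) * β ^ (D + 1)) * (6 / 5 * L ^ D) =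
        L ^ D / ((D + 1).factorial * β ^ (D + 1)) := by
      field_simp
    rw [h2]
    gcongr
  refine le_csInf ⟨‖T - 0‖, 0, ?_, rfl⟩ ?_
  · simpa using hnpos
  rintro _ ⟨A, hA, rfl⟩
  have hmain := rpow_div_le_norm_sub_sq hs hK0 hnpos hT hA hf hfK
  rw [← sq_le_sq₀ (by positivity) (norm_nonneg _)]
  refine le_trans ?_ hmain
  have e : ∀ {x y : ℝ}, 0 ≤ x → (x ^ y) ^ 2 = x ^ (2 * y) := fun hx => by
    rw [← Real.rpow_mul_natCast hx]
    congr 1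
    push_cast
    ring
  have h4 : (√(1 / (4 * s - 2)) * B ^ s * Real.log (2 * (n : ℝ)) ^ (D * s) /
      (n : ℝ) ^ (s - 1 / 2)) ^ 2 = 1 / (4 * s - 2) *
        ((B * Real.log (2 * (n : ℝ)) ^ D) ^ (2 * s) * (n : ℝ) ^ (-(2 * s - 1))) := by
    rw [div_pow, mul_pow, mul_pow, Real.sq_sqrt (div_nonneg (by norm_num) (by linarith)),
      e hB0.le, e hl0.le, e hn0.le, Real.rpow_neg hn0.le,
      Real.mul_rpow hB0.le (by positivity), ← Real.rpow_natCast (Real.log (2 * (n : ℝ))),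
      ← Real.rpow_mul hl0.le, show 2 * (s - 1 / 2) = 2 * s - 1 by ring,
      show 2 * ((D : ℝ) * s) = D * (2 * s) by ring]
    ring
  rw [h4]
  have h5 : (B * Real.log (2 * (n : ℝ)) ^ D) ^ (2 * s) ≤ K⁻¹ ^ (2 * s) :=
    Real.rpow_le_rpow (by positivity) hBK (by linarith)
  have h6 : 1 / (4 * s - 2) ≤ 1 / (2 * s - 1) :=
    one_div_le_one_div_of_le (by linarith) (by linarith)
  have h7 : 0 ≤ 1 / (4 * s - 2) := div_nonneg (by norm_num) (by linarith)
  have h8 := h7.trans h6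
  calc _ ≤ 1 / (2 * s - 1) * (K⁻¹ ^ (2 * s) * (n : ℝ) ^ (-(2 * s - 1))) := by gcongr
    _ = _ := by ring

/-- Corollary 12 of Cobos–Kühn–Sickel. For `d ∈ ℕ` and `s > 1/2`:
`a_n(I_d : H^{s,2}_mix(𝕋^d) → L_∞(𝕋^d))
   ≤ √(2/(2s-1)) ((3√2)^d/(d-1)!)^s (ln n)^{(d-1)s} / n^{s-1/2}`
for `n > max(27^d, e^{4(d-1)s/(2s-1)})`, and
`a_n(I_d : H^{s,2}_mix(𝕋^d) → L_∞(𝕋^d))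
   ≥ √(1/(4s-2)) (5/(6·d!·(1+ln√12)^d))^s (ln(2n))^{(d-1)s} / n^{s-1/2}`
for `n > (12e²)^d`. -/
theorem statement11 (d : ℕ) (hd : 0 < d) (s : ℝ) (hs : 1 / 2 < s)
    (T : ellTwo d →L[ℂ] Lp ℂ ⊤ (torusMeasure d))
    (hT : ∀ (c : ellTwo d) (k : ZLat d), fourierCoef (⇑(T c)) k = c k / (wMix d s 2 k : ℂ)) :
    (∀ n : ℕ,
      max ((27 : ℝ) ^ d) (Real.exp (4 * ((d : ℝ) - 1) * s / (2 * s - 1))) < (n : ℝ) →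
      approxNum T n ≤
        Real.sqrt (2 / (2 * s - 1)) *
          ((3 * Real.sqrt 2) ^ d / (Nat.factorial (d - 1) : ℝ)) ^ s *
          Real.log n ^ (((d : ℝ) - 1) * s) / (n : ℝ) ^ (s - 1 / 2)) ∧
    (∀ n : ℕ, ((12 : ℝ) * Real.exp 1 ^ 2) ^ d < (n : ℝ) →
      Real.sqrt (1 / (4 * s - 2)) *
          (5 / (6 * (Nat.factorial d : ℝ) * (1 + Real.log (Real.sqrt 12)) ^ d)) ^ s *
          Real.log (2 * (n : ℝ)) ^ (((d : ℝ) - 1) * s) / (n : ℝ) ^ (s - 1 / 2) ≤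
        approxNum T n) := by
  obtain ⟨D, rfl⟩ := Nat.exists_eq_succ_of_ne_zero hd.ne'
  have hD : ((D.succ : ℕ) : ℝ) - 1 = D := by
    push_cast
    ring
  rw [hD]
  exact ⟨fun n hn => approxNum_mixed_le hs T hT ((le_max_left _ _).trans_lt hn)
    ((le_max_right _ _).trans_lt hn), fun n hn => le_approxNum_mixed hs T hT hn⟩
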